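/- arXiv:1608.05458 — 2 statements merged into one kernel-verified Lean document; each statement's English description precedes it below -/
import Mathlib

section
/- Let r and s be positive integers. If 1 ≤ r ≤ 3, then M(2^r·3^s) = 11 if s = 1, M(2^r·3^s) = 9 if s = 2, and M(2^r·3^s) = 7 if s ≥ 3. If r ≥ 4, then M(2^r·3^s) = 9 if s = 1, M(2^r·3^s) = 7 if s = 2, and M(2^r·3^s) = 5 if s ≥ 3. -/
/-- A pair of integers `(a, b)` is multiplicatively dependent: `ab ≠ 0` and
there is a nonzero pair of integer exponents `(k₁, k₂)` with `a^k₁ * b^k₂ = 1`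
(evaluated in `ℚ`). -/
def MultDepPair (a b : ℤ) : Prop :=
  a * b ≠ 0 ∧ ∃ k : ℤ × ℤ, k ≠ 0 ∧ (a : ℚ) ^ k.1 * (b : ℚ) ^ k.2 = 1

/-- `MSet d` is the set of multiplicatively dependent pairs `(a, b) ∈ ℤ²`
with difference `b - a = d`. -/
def MSet (d : ℤ) : Set (ℤ × ℤ) :=
  {p | MultDepPair p.1 p.2 ∧ p.2 - p.1 = d}

/-- `M d` is the number of multiplicatively dependent pairs with difference `d`. -/
noncomputable def M (d : ℤ) : ℕ := (MSet d).ncard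

/-- `g` is a perfect power: `g = a ^ k` with `a ≥ 2`, `k ≥ 2`. -/
def IsPerfectPow (g : ℕ) : Prop := ∃ a k : ℕ, 2 ≤ a ∧ 2 ≤ k ∧ g = a ^ k

/-- `Nplus d` is the number of primitive solutions `(g, x, y)` of `g^y + g^x = d`
with `g ≥ 2` not a perfect power and `y > x ≥ 1`. -/
noncomputable def Nplus (d : ℕ) : ℕ :=
  {T : ℕ × ℕ × ℕ | 2 ≤ T.1 ∧ 1 ≤ T.2.1 ∧ T.2.1 < T.2.2 ∧ ¬ IsPerfectPow T.1 ∧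
    T.1 ^ T.2.2 + T.1 ^ T.2.1 = d}.ncard

/-- `Nminus d` is the number of primitive solutions `(g, x, y)` of `g^y - g^x = d`
with `g ≥ 2` not a perfect power and `y > x ≥ 1`. -/
noncomputable def Nminus (d : ℕ) : ℕ :=
  {T : ℕ × ℕ × ℕ | 2 ≤ T.1 ∧ 1 ≤ T.2.1 ∧ T.2.1 < T.2.2 ∧ ¬ IsPerfectPow T.1 ∧
    T.1 ^ T.2.2 = T.1 ^ T.2.1 + d}.ncard

/-- Multiplicative dependence of nonzero integers in terms of natural powers of absolute values. -/
lemma multDepPair_iff_natAbs_pow_eq {a b : ℤ} :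
    MultDepPair a b ↔ a ≠ 0 ∧ b ≠ 0 ∧
      ∃ m n : ℕ, (m ≠ 0 ∨ n ≠ 0) ∧ a.natAbs ^ m = b.natAbs ^ n := by
  constructor
  · rintro ⟨hab, ⟨k, l⟩, hk, h⟩
    have ha : a ≠ 0 := left_ne_zero_of_mul hab
    have hb : b ≠ 0 := right_ne_zero_of_mul hab
    refine ⟨ha, hb, k.natAbs, l.natAbs, ?_, ?_⟩
    · by_contra! hc
      exact hk (by ext <;> simp <;> omega)
    · have hA : (a.natAbs : ℚ) ≠ 0 := by simpa using ha
      have hB : (b.natAbs : ℚ) ≠ 0 := by simpa using hb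
      have habs : (a.natAbs : ℚ) ^ k * (b.natAbs : ℚ) ^ l = 1 := by
        have := congrArg abs h
        simpa [abs_mul, abs_zpow, Nat.cast_natAbs] using this
      obtain ⟨m, rfl | rfl⟩ := k.eq_nat_or_neg <;> obtain ⟨n, rfl | rfl⟩ := l.eq_nat_or_neg <;>
        simp only [zpow_neg, zpow_natCast, Int.natAbs_neg, Int.natAbs_natCast] at habs ⊢
      · have h1 : a.natAbs ^ m * b.natAbs ^ n = 1 := by exact_mod_cast habs
        rw [Nat.eq_one_of_mul_eq_one_right h1, Nat.eq_one_of_mul_eq_one_left h1]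
      · field_simp at habs
        exact_mod_cast habs
      · field_simp at habs
        exact_mod_cast habs.symm
      · rw [← mul_inv, inv_eq_one] at habs
        have h1 : a.natAbs ^ m * b.natAbs ^ n = 1 := by exact_mod_cast habs
        rw [Nat.eq_one_of_mul_eq_one_right h1, Nat.eq_one_of_mul_eq_one_left h1]
  · rintro ⟨ha, hb, m, n, hmn, h⟩
    refine ⟨mul_ne_zero ha hb, (2 * m, -(2 * n)), ?_, ?_⟩
    · intro hc
      simp only [Prod.mk_eq_zero] at hc
      omega
    · have hb' : (b : ℚ) ≠ 0 := by exact_mod_cast hb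
      have h2 : (a ^ 2) ^ m = (b ^ 2) ^ n := by
        rw [← Int.natAbs_sq a, ← Int.natAbs_sq b, ← pow_mul, ← pow_mul, mul_comm 2 m,
          mul_comm 2 n, pow_mul, pow_mul]
        exact_mod_cast congrArg (· ^ 2) h
      have h3 : (a : ℚ) ^ (2 * m) = (b : ℚ) ^ (2 * n) := by
        rw [pow_mul, pow_mul]
        exact_mod_cast h2
      have e1 : (2 * m : ℤ) = ((2 * m : ℕ) : ℤ) := by push_cast; ring
      have e2 : (2 * n : ℤ) = ((2 * n : ℕ) : ℤ) := by push_cast; ring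
      simp only [zpow_neg]
      rw [e1, e2, zpow_natCast, zpow_natCast, h3]
      exact mul_inv_cancel₀ (pow_ne_zero _ hb')

lemma multDepPair_of_pow {a b u : ℤ} {x y : ℕ} (hu : u ≠ 0) (hx : x ≠ 0)
    (ha : a = u ^ x ∨ a = -u ^ x) (hb : b = u ^ y ∨ b = -u ^ y) : MultDepPair a b := by
  have hA : a.natAbs = u.natAbs ^ x := by rcases ha with rfl | rfl <;> simp [Int.natAbs_pow]
  have hB : b.natAbs = u.natAbs ^ y := by rcases hb with rfl | rfl <;> simp [Int.natAbs_pow]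
  refine multDepPair_iff_natAbs_pow_eq.2 ⟨?_, ?_, y, x, Or.inr hx, ?_⟩
  · rcases ha with rfl | rfl <;> simp [hu]
  · rcases hb with rfl | rfl <;> simp [hu]
  · rw [hA, hB, ← pow_mul, ← pow_mul, mul_comm]

lemma M_eq_ncard (d : ℤ) : M d = {a : ℤ | MultDepPair a (a + d)}.ncard := by
  have h : MSet d = (fun a : ℤ => (a, a + d)) '' {a : ℤ | MultDepPair a (a + d)} := by
    ext ⟨a, b⟩
    simp only [MSet, Set.mem_ofPred_eq, Set.mem_image, Prod.mk.injEq]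
    constructor
    · rintro ⟨h, rfl⟩
      exact ⟨a, by simpa using h, rfl, by ring⟩
    · rintro ⟨c, h, rfl, rfl⟩
      exact ⟨h, by ring⟩
  rw [M, h, Set.ncard_image_of_injective _ fun a b h => (Prod.mk.inj h).1]

lemma two_pow_add_one_eq_three_pow {c s : ℕ} (hc : 1 ≤ c) (h : 2 ^ c + 1 = 3 ^ s) :
    (c = 1 ∧ s = 1) ∨ (c = 3 ∧ s = 2) := by
  have hc4 : c < 4 := by
    by_contra! hc4
    obtain ⟨e, rfl⟩ := Nat.exists_eq_add_of_le hc4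
    have h16 : 3 ^ s % 16 = 1 := by rw [← h, pow_add]; omega
    have h5 : ¬ 5 ∣ 2 ^ (4 + e) := fun h5 =>
      absurd (Nat.prime_five.dvd_of_dvd_pow h5) (by norm_num)
    have hs := Nat.div_add_mod s 4
    have hlt := Nat.mod_lt s (show 4 > 0 by norm_num)
    have h81 : 3 ^ s = 81 ^ (s / 4) * 3 ^ (s % 4) := by
      conv_lhs => rw [← hs, pow_add, pow_mul]
      norm_num
    have m16 : 81 ^ (s / 4) % 16 = 1 := by simp [Nat.pow_mod]
    have m5 : 81 ^ (s / 4) % 5 = 1 := by simp [Nat.pow_mod]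
    generalize s % 4 = t at *
    interval_cases t <;> omega
  have hs3 : s < 3 := by
    by_contra! hs3
    have := Nat.pow_le_pow_right (show 3 > 0 by norm_num) hs3
    interval_cases c <;> omega
  interval_cases c <;> interval_cases s <;> simp_all

lemma three_pow_add_one_eq_two_pow {c s : ℕ} (hs : 1 ≤ s) (h : 3 ^ s + 1 = 2 ^ c) :
    c = 2 ∧ s = 1 := by
  have hc3 : c < 3 := by
    by_contra! hc3
    obtain ⟨e, rfl⟩ := Nat.exists_eq_add_of_le hc3
    rw [pow_add] at h
    have hsd := Nat.div_add_mod s 2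
    have h9 : 3 ^ s = 9 ^ (s / 2) * 3 ^ (s % 2) := by
      conv_lhs => rw [← hsd, pow_add, pow_mul]
      norm_num
    have m8 : 9 ^ (s / 2) % 8 = 1 := by simp [Nat.pow_mod]
    rcases Nat.mod_two_eq_zero_or_one s with h2 | h2 <;> rw [h2] at h9 <;> omega
  have hs2 : s < 2 := by
    by_contra! hs2
    have := Nat.pow_le_pow_right (show 3 > 0 by norm_num) hs2
    interval_cases c <;> omega
  interval_cases c <;> interval_cases s <;> simp_all

lemma eq_pow_of_coprime_of_mul_eq {p q A e r s : ℕ} (hp : p.Prime) (hq : q.Prime)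
    (hA : p ∣ A) (hA' : ¬ q ∣ A) (hcop : A.Coprime e)
    (h : A * e = p ^ r * q ^ s) : A = p ^ r ∧ e = q ^ s := by
  have h1 : A ∣ p ^ r := by
    have : A.Coprime (q ^ s) := (((Nat.Prime.coprime_iff_not_dvd hq).2 hA').symm).pow_right s
    exact this.dvd_of_dvd_mul_right (h ▸ dvd_mul_right A e)
  have h2 : p ^ r ∣ A := by
    have : (p ^ r).Coprime e := (hcop.coprime_dvd_left hA).pow_left r
    exact this.dvd_of_dvd_mul_right (h ▸ dvd_mul_right _ _)
  have h3 : A = p ^ r := Nat.dvd_antisymm h1 h2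
  refine ⟨h3, ?_⟩
  rw [h3] at h
  exact Nat.eq_of_mul_eq_mul_left (pow_pos hp.pos r) h

lemma exists_eq_pow_of_pow_eq_prime_pow {p r k n C : ℕ} (hp : p.Prime) (hC : 2 ≤ C) (hn : n ≠ 0)
    (h : (p ^ r) ^ k = C ^ n) : ∃ c, 1 ≤ c ∧ C = p ^ c := by
  have hd : C ∣ p ^ (r * k) := by rw [pow_mul, h]; exact dvd_pow_self C hn
  obtain ⟨c, -, rfl⟩ := (Nat.dvd_prime_pow hp).1 hd
  refine ⟨c, Nat.pos_of_ne_zero ?_, rfl⟩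
  rintro rfl
  simp at hC

lemma factors_of_mul_eq {A C e k n r s : ℕ} (hA : 2 ≤ A) (hC : 2 ≤ C) (hk : k ≠ 0) (hn : n ≠ 0)
    (hAC : A ^ k = C ^ n) (he : e = C + 1 ∨ C = e + 1) (h : A * e = 2 ^ r * 3 ^ s) :
    (A = 2 ^ r ∧ e = 3 ^ s ∧ ∃ c, 1 ≤ c ∧ C = 2 ^ c) ∨
      (A = 3 ^ s ∧ e = 2 ^ r ∧ ∃ c, 1 ≤ c ∧ C = 3 ^ c) := by
  have hCe : C.Coprime e := by rcases he with rfl | rfl <;> simp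
  have hcop : A.Coprime e := by
    have : (A ^ k).Coprime e := hAC ▸ hCe.pow_left n
    exact (Nat.coprime_pow_left_iff (Nat.pos_of_ne_zero hk) _ _).1 this
  by_cases h2 : 2 ∣ A <;> by_cases h3 : 3 ∣ A
  · have he1 : e = 1 := by
      have c2 : e.Coprime (2 ^ r) := ((hcop.coprime_dvd_left h2).pow_left r).symm
      have c3 : e.Coprime (3 ^ s) := ((hcop.coprime_dvd_left h3).pow_left s).symm
      exact Nat.Coprime.eq_one_of_dvd (c2.mul_right c3) (h ▸ dvd_mul_left e A)
    have : 3 ∣ C := Nat.prime_three.dvd_of_dvd_pow (hAC ▸ dvd_pow h3 hk)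
    omega
  · obtain ⟨rfl, rfl⟩ := eq_pow_of_coprime_of_mul_eq Nat.prime_two Nat.prime_three
      h2 h3 hcop h
    exact Or.inl ⟨rfl, rfl, exists_eq_pow_of_pow_eq_prime_pow Nat.prime_two hC hn hAC⟩
  · obtain ⟨rfl, rfl⟩ := eq_pow_of_coprime_of_mul_eq Nat.prime_three Nat.prime_two
      h3 h2 hcop (h.trans (mul_comm _ _))
    exact Or.inr ⟨rfl, rfl, exists_eq_pow_of_pow_eq_prime_pow Nat.prime_three hC hn hAC⟩
  · have c2 : A.Coprime (2 ^ r) :=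
      (((Nat.Prime.coprime_iff_not_dvd Nat.prime_two).2 h2).symm).pow_right r
    have c3 : A.Coprime (3 ^ s) :=
      (((Nat.Prime.coprime_iff_not_dvd Nat.prime_three).2 h3).symm).pow_right s
    have := Nat.Coprime.eq_one_of_dvd (c2.mul_right c3) (h ▸ dvd_mul_right A e)
    omega

/-- If `A < B` are multiplicatively dependent, then so are `A` and `B / A`. -/
lemma exists_eq_mul_of_pow_eq {A B m n : ℕ} (hA : 2 ≤ A) (hAB : A < B) (hmn : m ≠ 0 ∨ n ≠ 0)
    (h : A ^ m = B ^ n) :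
    n ≠ 0 ∧ ∃ C k, 2 ≤ C ∧ k ≠ 0 ∧ B = A * C ∧ A ^ k = C ^ n := by
  have hn : n ≠ 0 := by
    rintro rfl
    rw [pow_zero] at h
    have := (Nat.pow_eq_one.1 h)
    omega
  have hnm : n < m := by
    by_contra! hmn'
    have h1 : A ^ m ≤ A ^ n := Nat.pow_le_pow_right (by omega) hmn'
    have h2 : A ^ n < B ^ n := Nat.pow_lt_pow_left hAB hn
    omega
  obtain ⟨C, rfl⟩ : A ∣ B := (Nat.pow_dvd_pow_iff hn).1 (h ▸ pow_dvd_pow A hnm.le)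
  refine ⟨hn, C, m - n, ?_, by omega, rfl, ?_⟩
  · by_contra! hC
    interval_cases C <;> omega
  · rw [mul_pow, ← Nat.add_sub_of_le hnm.le, pow_add] at h
    exact Nat.eq_of_mul_eq_mul_left (by positivity) h

lemma solutions_of_eq_add {A B m n r s : ℕ} (hr : 1 ≤ r) (hs : 1 ≤ s) (hA : 2 ≤ A) (hAB : A < B)
    (hmn : m ≠ 0 ∨ n ≠ 0) (h : A ^ m = B ^ n) (hd : B = A + 2 ^ r * 3 ^ s) :
    (A = 2 ^ r ∧ s = 1) ∨ (A = 3 ^ s ∧ (r = 1 ∨ r = 3)) := by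
  obtain ⟨hn, C, k, hC, hk, rfl, hAC⟩ := exists_eq_mul_of_pow_eq hA hAB hmn h
  obtain ⟨e, rfl⟩ : ∃ e, C = e + 1 := ⟨C - 1, by omega⟩
  have he : A * e = 2 ^ r * 3 ^ s := by linarith
  rcases factors_of_mul_eq hA hC hk hn hAC (Or.inr rfl) he with
    ⟨rfl, rfl, c, hc, h1⟩ | ⟨rfl, rfl, c, hc, h1⟩
  · exact Or.inl ⟨rfl, (three_pow_add_one_eq_two_pow hs h1).2⟩
  · exact Or.inr ⟨rfl, (two_pow_add_one_eq_three_pow hr h1).imp And.left And.left⟩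

lemma solutions_of_add_eq {A B m n r s : ℕ} (hA : 2 ≤ A) (hAB : A < B)
    (hmn : m ≠ 0 ∨ n ≠ 0) (h : A ^ m = B ^ n) (hd : A + B = 2 ^ r * 3 ^ s) :
    (A = 2 ^ r ∧ (s = 1 ∨ s = 2)) ∨ (A = 3 ^ s ∧ r = 2) := by
  obtain ⟨hn, C, k, hC, hk, rfl, hAC⟩ := exists_eq_mul_of_pow_eq hA hAB hmn h
  have he : A * (C + 1) = 2 ^ r * 3 ^ s := by linarith
  rcases factors_of_mul_eq hA hC hk hn hAC (Or.inl rfl) he with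
    ⟨rfl, h1, c, hc, rfl⟩ | ⟨rfl, h1, c, hc, rfl⟩
  · exact Or.inl ⟨rfl, (two_pow_add_one_eq_three_pow hc h1).imp And.right And.right⟩
  · exact Or.inr ⟨rfl, (three_pow_add_one_eq_two_pow hc h1).1⟩

/-- The first entries of the multiplicatively dependent pairs with difference `2 ^ r * 3 ^ s`. -/
lemma multDepPair_add_two_pow_mul_three_pow_iff {r s : ℕ} (hr : 1 ≤ r) (hs : 1 ≤ s) (a : ℤ) :
    MultDepPair a (a + 2 ^ r * 3 ^ s) ↔
      a = 1 ∨ a = -1 ∨ a = 1 - 2 ^ r * 3 ^ s ∨ a = -1 - 2 ^ r * 3 ^ s ∨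
      a = -(2 ^ (r - 1) * 3 ^ s) ∨
      (s = 1 ∧ (a = 2 ^ r ∨ a = -4 * 2 ^ r ∨ a = -2 ^ r ∨ a = -2 * 2 ^ r)) ∨
      (s = 2 ∧ (a = -2 ^ r ∨ a = -8 * 2 ^ r)) ∨
      (r = 1 ∧ (a = 3 ^ s ∨ a = -3 * 3 ^ s)) ∨
      (r = 2 ∧ (a = -3 ^ s ∨ a = -3 * 3 ^ s)) ∨
      (r = 3 ∧ (a = 3 ^ s ∨ a = -9 * 3 ^ s)) := by
  have hhalf : a = -(2 ^ (r - 1) * 3 ^ s) ↔ 2 * a = -(2 ^ r * 3 ^ s) := by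
    obtain ⟨k, rfl⟩ := Nat.exists_eq_add_of_le' hr
    rw [Nat.add_sub_cancel, pow_succ, mul_right_comm]
    omega
  rw [hhalf]
  obtain ⟨X, hX⟩ : ∃ X : ℕ, X = 2 ^ r := ⟨_, rfl⟩
  obtain ⟨Y, hY⟩ : ∃ Y : ℕ, Y = 3 ^ s := ⟨_, rfl⟩
  have hXZ : (2 : ℤ) ^ r = X := by rw [hX]; norm_num
  have hYZ : (3 : ℤ) ^ s = Y := by rw [hY]; norm_num
  have hX2 : 2 ≤ X := hX ▸ Nat.pow_le_pow_right (n := 2) (by norm_num) hr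
  have hY3 : 3 ≤ Y := hY ▸ Nat.pow_le_pow_right (n := 3) (by norm_num) hs
  obtain ⟨d, hd⟩ : ∃ d : ℕ, d = X * Y := ⟨_, rfl⟩
  have hd6 : 6 ≤ d := hd ▸ Nat.mul_le_mul hX2 hY3
  have hdZ : (2 : ℤ) ^ r * 3 ^ s = d := by rw [hXZ, hYZ, hd]; norm_num
  have hs1 : s = 1 → (d : ℤ) = 3 * X := by rintro rfl; rw [hd, hY]; push_cast; ring
  have hs2 : s = 2 → (d : ℤ) = 9 * X := by rintro rfl; rw [hd, hY]; push_cast; ring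
  have hr1 : r = 1 → (d : ℤ) = 2 * Y := by rintro rfl; rw [hd, hX]; push_cast; ring
  have hr2 : r = 2 → (d : ℤ) = 4 * Y := by rintro rfl; rw [hd, hX]; push_cast; ring
  have hr3 : r = 3 → (d : ℤ) = 8 * Y := by rintro rfl; rw [hd, hX]; push_cast; ring
  rw [hdZ]
  constructor
  · intro hM
    obtain ⟨ha, hb, m, n, hmn, h⟩ := multDepPair_iff_natAbs_pow_eq.1 hM
    rw [hXZ, hYZ]
    by_cases hA : a.natAbs = 1
    · rcases Int.natAbs_eq_iff.1 hA with h1 | h1 <;> simp [h1]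
    by_cases hB : (a + d).natAbs = 1
    · rcases Int.natAbs_eq_iff.1 hB with h1 | h1 <;> grind
    have key : ∀ {A B m n : ℕ}, 2 ≤ A → A < B → (m ≠ 0 ∨ n ≠ 0) → A ^ m = B ^ n →
        (B = A + d → (A = X ∧ s = 1) ∨ (A = Y ∧ (r = 1 ∨ r = 3))) ∧
        (A + B = d → (A = X ∧ (s = 1 ∨ s = 2)) ∨ (A = Y ∧ r = 2)) := by
      intro A B m n hA hAB hmn h
      rw [hd, hX, hY]
      exact ⟨solutions_of_eq_add hr hs hA hAB hmn h, solutions_of_add_eq hA hAB hmn h⟩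
    rcases lt_trichotomy a.natAbs (a + d).natAbs with hlt | heq | hlt
    · obtain ⟨k1, k2⟩ := key (by omega) hlt hmn h
      clear key hM hmn h hX hY hXZ hYZ hd hdZ
      by_cases hpos : 0 < a
      · have := k1 (by clear * - hpos; omega)
        have h1 : a = a.natAbs := by clear * - hpos; omega
        grind
      · have := k2 (by clear * - hpos hlt; omega)
        have h1 : a = -a.natAbs := by clear * - hpos; omega
        grind
    · have h1 : 2 * a = -d := by clear * - heq hd6; omega
      simp [h1]
    · obtain ⟨k1, k2⟩ := key (by omega) hlt hmn.symm h.symm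
      clear key hM hmn h hX hY hXZ hYZ hd hdZ
      by_cases hpos : 0 < a + d
      · have := k2 (by clear * - hpos hlt; omega)
        have h1 : a = (a + d).natAbs - d := by clear * - hpos; omega
        grind
      · have := k1 (by clear * - hpos; omega)
        have h1 : a = -(a + d).natAbs - d := by clear * - hpos; omega
        grind
  · have hr0 : r ≠ 0 := by omega
    have hs0 : s ≠ 0 := by omega
    have hone : ∀ {a b : ℤ}, a ≠ 0 → b ≠ 0 → (a.natAbs = 1 ∨ b.natAbs = 1) → MultDepPair a b := by
      intro a b ha hb h
      rw [multDepPair_iff_natAbs_pow_eq]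
      rcases h with h | h
      · exact ⟨ha, hb, 1, 0, by simp [h]⟩
      · exact ⟨ha, hb, 0, 1, by simp [h]⟩
    have e2 : ∀ k : ℕ, (2 : ℤ) ^ (r + k) = 2 ^ k * X := fun k => by rw [pow_add, hXZ]; ring
    have e3 : ∀ k : ℕ, (3 : ℤ) ^ (s + k) = 3 ^ k * Y := fun k => by rw [pow_add, hYZ]; ring
    have two : ∀ i j : ℕ, (a = 2 ^ i * X ∨ a = -(2 ^ i * X)) →
        (a + d = 2 ^ j * X ∨ a + d = -(2 ^ j * X)) → MultDepPair a (a + d) := by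
      intro i j h1 h2
      exact multDepPair_of_pow (u := 2) (x := r + i) (y := r + j) (by norm_num) (by omega)
        (by rwa [e2]) (by rwa [e2])
    have three : ∀ i j : ℕ, (a = 3 ^ i * Y ∨ a = -(3 ^ i * Y)) →
        (a + d = 3 ^ j * Y ∨ a + d = -(3 ^ j * Y)) → MultDepPair a (a + d) := by
      intro i j h1 h2
      exact multDepPair_of_pow (u := 3) (x := s + i) (y := s + j) (by norm_num) (by omega)
        (by rwa [e3]) (by rwa [e3])
    rw [hXZ, hYZ]
    rintro (h | h | h | h | h | ⟨hs', h | h | h | h⟩ | ⟨hs', h | h⟩ | ⟨hr', h | h⟩ | ⟨hr', h | h⟩ |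
      ⟨hr', h | h⟩)
    · exact hone (by omega) (by omega) (by omega)
    · exact hone (by omega) (by omega) (by omega)
    · exact hone (by omega) (by omega) (by omega)
    · exact hone (by omega) (by omega) (by omega)
    · exact multDepPair_of_pow (u := a) (x := 1) (y := 1) (by omega) (by omega) (by simp)
        (by simp only [pow_one]; omega)
    · exact two 0 2 (by omega) (by omega)
    · exact two 2 0 (by omega) (by omega)
    · exact two 0 1 (by omega) (by omega)
    · exact two 1 0 (by omega) (by omega)
    · exact two 0 3 (by omega) (by omega)
    · exact two 3 0 (by omega) (by omega)
    · exact three 0 1 (by omega) (by omega)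
    · exact three 1 0 (by omega) (by omega)
    · exact three 0 1 (by omega) (by omega)
    · exact three 1 0 (by omega) (by omega)
    · exact three 0 2 (by omega) (by omega)
    · exact three 2 0 (by omega) (by omega)

lemma M_two_pow_mul_three_pow {r s : ℕ} (hr : 1 ≤ r) (hs : 1 ≤ s) (S : Finset ℤ)
    (hS : ∀ a : ℤ, a ∈ S ↔
      a = 1 ∨ a = -1 ∨ a = 1 - 2 ^ r * 3 ^ s ∨ a = -1 - 2 ^ r * 3 ^ s ∨
      a = -(2 ^ (r - 1) * 3 ^ s) ∨
      (s = 1 ∧ (a = 2 ^ r ∨ a = -4 * 2 ^ r ∨ a = -2 ^ r ∨ a = -2 * 2 ^ r)) ∨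
      (s = 2 ∧ (a = -2 ^ r ∨ a = -8 * 2 ^ r)) ∨
      (r = 1 ∧ (a = 3 ^ s ∨ a = -3 * 3 ^ s)) ∨
      (r = 2 ∧ (a = -3 ^ s ∨ a = -3 * 3 ^ s)) ∨
      (r = 3 ∧ (a = 3 ^ s ∨ a = -9 * 3 ^ s))) :
    M ((2 ^ r * 3 ^ s : ℕ) : ℤ) = S.card := by
  rw [M_eq_ncard, ← Set.ncard_coe_finset S]
  congr 1
  ext a
  push_cast
  rw [Set.mem_ofPred_eq, multDepPair_add_two_pow_mul_three_pow_iff hr hs, Finset.mem_coe, hS]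

set_option maxHeartbeats 4000000 in
theorem stmt7 (r s : ℕ) (hr : 1 ≤ r) (hs : 1 ≤ s) :
    (r ≤ 3 →
      (s = 1 → M ((2 ^ r * 3 ^ s : ℕ) : ℤ) = 11) ∧
      (s = 2 → M ((2 ^ r * 3 ^ s : ℕ) : ℤ) = 9) ∧
      (3 ≤ s → M ((2 ^ r * 3 ^ s : ℕ) : ℤ) = 7)) ∧
    (4 ≤ r →
      (s = 1 → M ((2 ^ r * 3 ^ s : ℕ) : ℤ) = 9) ∧
      (s = 2 → M ((2 ^ r * 3 ^ s : ℕ) : ℤ) = 7) ∧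
      (3 ≤ s → M ((2 ^ r * 3 ^ s : ℕ) : ℤ) = 5)) := by
  obtain ⟨X, hX'⟩ : ∃ X : ℤ, 2 ^ (r - 1) = X := ⟨_, rfl⟩
  have hX : (2 : ℤ) ^ r = 2 * X := by rw [← hX', ← pow_succ', Nat.sub_add_cancel hr]
  obtain ⟨Y, hY⟩ : ∃ Y : ℤ, 3 ^ s = Y := ⟨_, rfl⟩
  have hX1 : 1 ≤ X := by
    have : (0 : ℤ) < 2 ^ r := by positivity
    omega
  obtain ⟨h, hh⟩ : ∃ h : ℤ, h = X * Y := ⟨_, rfl⟩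
  have hd : (2 : ℤ) ^ r * 3 ^ s = 2 * h := by rw [hX, hY, hh]; ring
  have hd' : (2 : ℤ) ^ (r - 1) * 3 ^ s = h := by rw [hX', hY, hh]
  have hY3 : 3 ≤ Y := by
    rw [← hY]
    exact_mod_cast Nat.pow_le_pow_right (n := 3) (by norm_num) hs
  have hh3 : 3 ≤ h := by nlinarith
  refine ⟨fun hr3 => ⟨?_, ?_, fun hs3 => ?_⟩, fun hr4 => ⟨?_, ?_, fun hs3 => ?_⟩⟩
  · rintro rfl
    interval_cases r
    · rw [M_two_pow_mul_three_pow hr hs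
        {1, -1, -5, -7, -3, 2, -8, -2, -4, 3, -9} fun a => by
          simp; tauto]
      decide
    · rw [M_two_pow_mul_three_pow hr hs
        {1, -1, -11, -13, -6, 4, -16, -4, -8, -3, -9} fun a => by
          simp; tauto]
      decide
    · rw [M_two_pow_mul_three_pow hr hs
        {1, -1, -23, -25, -12, 8, -32, -8, -16, 3, -27} fun a => by
          simp; tauto]
      decide
  · rintro rfl
    interval_cases r
    · rw [M_two_pow_mul_three_pow hr hs
        {1, -1, -17, -19, -9, -2, -16, 9, -27} fun a => by
          simp; tauto]
      decide
    · rw [M_two_pow_mul_three_pow hr hs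
        {1, -1, -35, -37, -18, -4, -32, -9, -27} fun a => by
          simp; tauto]
      decide
    · rw [M_two_pow_mul_three_pow hr hs
        {1, -1, -71, -73, -36, -8, -64, 9, -81} fun a => by
          simp; tauto]
      decide
  · interval_cases r
    · obtain rfl : X = 1 := by omega
      rw [M_two_pow_mul_three_pow hr hs
        {1, -1, 1 - 2 * Y, -1 - 2 * Y, -Y, Y, -3 * Y} fun a => by
          rw [hY]; simp only [Finset.mem_insert, Finset.mem_singleton]; grind]
      iterate 6 rw [Finset.card_insert_of_notMem (by
        simp only [Finset.mem_insert, Finset.mem_singleton]; grind)]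
      simp
    · obtain rfl : X = 2 := by omega
      rw [M_two_pow_mul_three_pow hr hs
        {1, -1, 1 - 4 * Y, -1 - 4 * Y, -2 * Y, -Y, -3 * Y} fun a => by
          rw [hY]; simp only [Finset.mem_insert, Finset.mem_singleton]; grind]
      iterate 6 rw [Finset.card_insert_of_notMem (by
        simp only [Finset.mem_insert, Finset.mem_singleton]; grind)]
      simp
    · obtain rfl : X = 4 := by omega
      rw [M_two_pow_mul_three_pow hr hs
        {1, -1, 1 - 8 * Y, -1 - 8 * Y, -4 * Y, Y, -9 * Y} fun a => by
          rw [hY]; simp only [Finset.mem_insert, Finset.mem_singleton]; grind]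
      iterate 6 rw [Finset.card_insert_of_notMem (by
        simp only [Finset.mem_insert, Finset.mem_singleton]; grind)]
      simp
  · rintro rfl
    obtain rfl : Y = 3 := by omega
    have hX8 : 8 ≤ X := by
      have : (2 : ℤ) ^ 4 ≤ 2 ^ r := pow_le_pow_right₀ (by norm_num) hr4
      omega
    rw [M_two_pow_mul_three_pow hr hs
      {1, -1, 1 - 6 * X, -1 - 6 * X, -3 * X, 2 * X, -8 * X, -2 * X, -4 * X} fun a => by
        rw [hd, hd', hX]; simp only [Finset.mem_insert, Finset.mem_singleton]; grind]
    iterate 8 rw [Finset.card_insert_of_notMem (by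
        simp only [Finset.mem_insert, Finset.mem_singleton]; grind)]
    simp
  · rintro rfl
    obtain rfl : Y = 9 := by omega
    rw [M_two_pow_mul_three_pow hr hs
      {1, -1, 1 - 18 * X, -1 - 18 * X, -9 * X, -2 * X, -16 * X} fun a => by
        rw [hd, hd', hX]; simp only [Finset.mem_insert, Finset.mem_singleton]; grind]
    iterate 6 rw [Finset.card_insert_of_notMem (by
        simp only [Finset.mem_insert, Finset.mem_singleton]; grind)]
    simp
  · rw [M_two_pow_mul_three_pow hr hs {1, -1, 1 - 2 * h, -1 - 2 * h, -h} fun a => by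
        rw [hd, hd']; simp only [Finset.mem_insert, Finset.mem_singleton]; grind]
    iterate 4 rw [Finset.card_insert_of_notMem (by
        simp only [Finset.mem_insert, Finset.mem_singleton]; grind)]
    simp
end

section
/- Assume the ABC conjecture. Then the set of six-tuples of positive integers (a, b, x₁, x₂, y₁, y₂) with a > 1, b > 1, x₁ > x₂, y₁ > y₂, a^{x₁} ≠ b^{y₁}, and a^{x₁} + a^{x₂} = b^{y₁} + b^{y₂} is finite. -/
/-- The ABC conjecture: for every `ε > 0` there is `K > 0` such that for all
nonzero integers `A, B, C` with `A + B = C` and `gcd(A, B) = 1`,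
`max(|A|,|B|,|C|) ≤ K * rad(|ABC|)^(1+ε)`, where `rad` is the product of the
distinct primes dividing the number. -/
def ABCConjecture : Prop :=
  ∀ ε : ℝ, 0 < ε → ∃ K : ℝ, 0 < K ∧ ∀ A B C : ℤ,
    A ≠ 0 → B ≠ 0 → C ≠ 0 → A + B = C → Int.gcd A B = 1 →
    ((max (max |A| |B|) |C| : ℤ) : ℝ) ≤
      K * ((∏ p ∈ (A * B * C).natAbs.primeFactors, p : ℕ) : ℝ) ^ (1 + ε)

/-- `ABCConjecture` in logarithmic form, for a sum `P + Q = S` of positive integers that need not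
be coprime; `M` is divisible by all primes dividing `P * S`. -/
theorem ABCConjecture.log_le (habc : ABCConjecture) {ε : ℝ} (hε : 0 < ε) :
    ∃ c : ℝ, 0 ≤ c ∧ ∀ P Q S M : ℕ, 0 < P → 0 < Q → 0 < M → P + Q = S →
      (∀ p : ℕ, p.Prime → p ∣ P * S → p ∣ M) →
      Real.log S ≤ (1 + ε) * (Real.log M + Real.log Q) + c := by
  obtain ⟨K, hK, h⟩ := habc ε hε
  refine ⟨max (Real.log K) 0, le_max_right _ _, ?_⟩
  intro P Q S M hP hQ hM hS hdiv
  obtain ⟨H, P', Q', hH, hco, rfl, rfl⟩ := Nat.exists_coprime' (Nat.gcd_pos_of_pos_left Q hP)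
  have hP' : 0 < P' := Nat.pos_of_mul_pos_right hP
  have hQ' : 0 < Q' := Nat.pos_of_mul_pos_right hQ
  subst hS
  have key := h P' Q' (P' + Q') (by positivity) (by positivity) (by positivity) rfl
    (by simpa using hco)
  have hsub : ((P' : ℤ) * Q' * (P' + Q')).natAbs = P' * Q' * (P' + Q') := by
    rw [← Int.natAbs_natCast (P' * Q' * (P' + Q'))]; push_cast; rfl
  rw [hsub] at key
  have hprod : (∏ p ∈ (P' * Q' * (P' + Q')).primeFactors, p) ≤ M * Q' := by
    have hMQ : 0 < M * Q' := Nat.mul_pos hM hQ'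
    refine le_trans (Finset.prod_le_prod_of_subset_of_one_le' (t := (M * Q').primeFactors) ?_ ?_)
      (Nat.le_of_dvd hMQ (Nat.prod_primeFactors_dvd _))
    · intro p hp
      have hpp := Nat.prime_of_mem_primeFactors hp
      have hd := Nat.dvd_of_mem_primeFactors hp
      refine Nat.mem_primeFactors.2 ⟨hpp, ?_, hMQ.ne'⟩
      rcases hpp.dvd_mul.1 hd with hd | hd
      · rcases hpp.dvd_mul.1 hd with hd | hd
        · exact Dvd.dvd.mul_right (hdiv p hpp (Dvd.dvd.mul_right (Dvd.dvd.mul_right hd _) _)) _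
        · exact Dvd.dvd.mul_left hd _
      · refine Dvd.dvd.mul_right (hdiv p hpp (Dvd.dvd.mul_left ?_ _)) _
        rw [← add_mul]
        exact Dvd.dvd.mul_right hd _
    · intro p hp _
      exact (Nat.prime_of_mem_primeFactors hp).one_le
  have hle : ((P' + Q' : ℕ) : ℝ) ≤ K * ((M * Q' : ℕ) : ℝ) ^ (1 + ε) := by
    calc ((P' + Q' : ℕ) : ℝ) ≤ ((max (max |(P' : ℤ)| |(Q' : ℤ)|) |(P' : ℤ) + Q'| : ℤ) : ℝ) := by
          have : ((P' + Q' : ℕ) : ℤ) ≤ max (max |(P' : ℤ)| |(Q' : ℤ)|) |(P' : ℤ) + Q'| := by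
            push_cast
            exact le_trans (le_abs_self _) (le_max_right _ _)
          exact_mod_cast this
      _ ≤ _ := key
      _ ≤ _ := by gcongr
  have hS' : (0 : ℝ) < ((P' + Q' : ℕ) : ℝ) := by positivity
  have hMr : (0 : ℝ) < M := by positivity
  have hQr : (0 : ℝ) < Q' := by positivity
  have hHr : (1 : ℝ) ≤ H := by exact_mod_cast hH
  have hlog := Real.log_le_log hS' hle
  rw [Real.log_mul hK.ne' (by positivity), Real.log_rpow (by positivity)] at hlog
  push_cast at hlog ⊢
  rw [Real.log_mul hMr.ne' hQr.ne'] at hlog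
  rw [← add_mul, Real.log_mul (by positivity) (by positivity),
    Real.log_mul hQr.ne' (by positivity)]
  have h1 := Real.log_nonneg hHr
  have h2 := le_max_left (Real.log K) 0
  nlinarith

theorem sq_dvd_belyi (s : ℤ) {p q : ℕ} (hp : 0 < p) (hq : 0 < q) :
    s ^ 2 ∣ (s - p) ^ p * (s + q) ^ q - (-(p : ℤ)) ^ p * (q : ℤ) ^ q := by
  have key : ∀ (c : ℤ) (k : ℕ), 0 < k → s ^ 2 ∣ (s + c) ^ k - (c ^ k + k * s * c ^ (k - 1)) := by
    intro c k hk
    obtain ⟨j, rfl⟩ : ∃ j, k = j + 1 := ⟨k - 1, by omega⟩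
    clear hk
    induction j with
    | zero => simp [add_comm]
    | succ j ih =>
      obtain ⟨t, ht⟩ := ih
      refine ⟨t * (s + c) + (j + 1) * c ^ j, ?_⟩
      have : (s + c) ^ (j + 1) = s ^ 2 * t + (c ^ (j + 1) + ((j + 1 : ℕ) : ℤ) * s * c ^ j) := by
        simpa [sub_eq_iff_eq_add] using ht
      rw [pow_succ (s + c), this]
      push_cast [Nat.add_sub_cancel]
      ring
  obtain ⟨t, ht⟩ := key (-(p : ℤ)) p hp
  obtain ⟨t', ht'⟩ := key q q hq
  obtain ⟨p, rfl⟩ : ∃ j, p = j + 1 := ⟨p - 1, by omega⟩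
  obtain ⟨q, rfl⟩ : ∃ j, q = j + 1 := ⟨q - 1, by omega⟩
  rw [sub_eq_iff_eq_add] at ht ht'
  rw [sub_eq_add_neg s, ht, ht']
  simp only [Nat.add_sub_cancel]
  refine ⟨t * (s ^ 2 * t' + ((q + 1 : ℕ) : ℤ) ^ (q + 1) * (1 + s)) +
    (-((p + 1 : ℕ) : ℤ)) ^ (p + 1) * (1 - s) * t' -
    (-((p + 1 : ℕ) : ℤ)) ^ (p + 1) * ((q + 1 : ℕ) : ℤ) ^ (q + 1), ?_⟩
  ring

/-- The bound on radicals obtained from the `ABC` conjecture through the Belyi polynomial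
`(t - z₁) ^ (z₂ - z₁) * (t - z₃) ^ (z₃ - z₂)`, which is critical only at `z₁`, `z₂`, `z₃`. -/
theorem ABCConjecture.log_le_of_lt (habc : ABCConjecture) {z₁ z₂ z₃ : ℤ} (h₁₂ : z₁ < z₂)
    (h₂₃ : z₂ < z₃) {δ : ℝ} (hδ : 0 < δ) :
    ∃ (c : ℝ) (t₀ : ℕ), ∀ t : ℕ, t₀ ≤ t → ∀ M₁ M₂ M₃ : ℕ, 0 < M₁ → 0 < M₂ → 0 < M₃ →
      (∀ p : ℕ, p.Prime → (p : ℤ) ∣ t - z₁ → p ∣ M₁) →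
      (∀ p : ℕ, p.Prime → (p : ℤ) ∣ t - z₂ → p ∣ M₂) →
      (∀ p : ℕ, p.Prime → (p : ℤ) ∣ t - z₃ → p ∣ M₃) →
      2 * Real.log t ≤ Real.log M₁ + Real.log M₂ + Real.log M₃ + δ * Real.log t + c := by
  obtain ⟨k, hk, rfl⟩ : ∃ k : ℕ, 0 < k ∧ z₁ = z₂ - k := ⟨(z₂ - z₁).toNat, by omega, by omega⟩
  obtain ⟨l, hl, rfl⟩ : ∃ l : ℕ, 0 < l ∧ z₃ = z₂ + l := ⟨(z₃ - z₂).toNat, by omega, by omega⟩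
  set κ : ℤ := (-(l : ℤ)) ^ l * (k : ℤ) ^ k with hκ
  have hκ0 : κ ≠ 0 :=
    mul_ne_zero (pow_ne_zero _ (neg_ne_zero.2 (by positivity))) (by positivity)
  have hD : (0 : ℝ) < (k + l : ℕ) := by positivity
  obtain ⟨c, hc0, hc⟩ := habc.log_le (ε := δ / (k + l : ℕ)) (by positivity)
  set ε : ℝ := δ / (k + l : ℕ) with hεdef
  have hε : 0 < ε := by positivity
  set C₁ : ℝ := Real.log κ.natAbs + (k + l + 3 : ℕ) * Real.log 2 with hC₁
  set c₁ : ℝ := (k + l : ℕ) * Real.log 2 + c with hc₁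
  have hlog2 : 0 < Real.log 2 := Real.log_pos (by norm_num)
  have hc₁0 : 0 ≤ c₁ := by positivity
  refine ⟨C₁ + c₁, 2 * (z₂.natAbs + k + l + κ.natAbs + 1), ?_⟩
  intro t ht M₁ M₂ M₃ hM₁ hM₂ hM₃ hp₁ hp₂ hp₃
  set s : ℤ := t - z₂ with hs
  obtain ⟨R, hR⟩ := sq_dvd_belyi s hl hk
  rw [← hκ] at hR
  set ψ : ℤ := (s - l) ^ l * (s + k) ^ k with hψ
  have hb₁ : (t : ℤ) ≤ 2 * (s - l) := by omega
  have hb₂ : s + k ≤ 2 * t := by omega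
  have hspos : 0 < s := by omega
  have htpos : 0 < t := by omega
  have htr : (0 : ℝ) < t := by exact_mod_cast htpos
  have hslpos : 0 < s - l := by omega
  have hskpos : 0 < s + k := by omega
  have hψκ : |κ| < ψ := by
    have h1 : s - l ≤ (s - l) ^ l := le_self_pow₀ (by omega) (by omega)
    have h2 : 1 ≤ (s + k) ^ k := one_le_pow₀ (by omega)
    have h3 : |κ| < s - l := by rw [Int.abs_eq_natAbs]; omega
    nlinarith
  have hψpos : 0 < ψ := lt_of_le_of_lt (abs_nonneg _) hψκ
  have hψκpos : 0 < ψ - κ := by linarith [le_abs_self κ]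
  have hRpos : 0 < R := by
    rw [hR] at hψκpos
    exact pos_of_mul_pos_right hψκpos (by positivity)
  have hbase : (t : ℝ) / 2 ≤ ((s - l : ℤ) : ℝ) := by
    have : ((t : ℤ) : ℝ) ≤ ((2 * (s - l) : ℤ) : ℝ) := by exact_mod_cast hb₁
    push_cast at this ⊢
    linarith
  have hslr : (0 : ℝ) < ((s - l : ℤ) : ℝ) := by exact_mod_cast hslpos
  have hskr : (0 : ℝ) < ((s + k : ℤ) : ℝ) := by exact_mod_cast hskpos
  have hsr : (0 : ℝ) < (s : ℝ) := by exact_mod_cast hspos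
  have hRr : (0 : ℝ) < (R : ℝ) := by exact_mod_cast hRpos
  have hψr : (0 : ℝ) < (ψ : ℝ) := by exact_mod_cast hψpos
  have hlogt2 : Real.log ((t : ℝ) / 2) = Real.log t - Real.log 2 :=
    Real.log_div htr.ne' (by norm_num)
  have hlogψ : Real.log ψ = l * Real.log ((s - l : ℤ) : ℝ) + k * Real.log ((s + k : ℤ) : ℝ) := by
    rw [hψ, Int.cast_mul, Int.cast_pow, Int.cast_pow, Real.log_mul (by positivity) (by positivity),
      Real.log_pow, Real.log_pow]
  have hsl_lower : Real.log t - Real.log 2 ≤ Real.log ((s - l : ℤ) : ℝ) := by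
    rw [← hlogt2]; exact Real.log_le_log (by positivity) hbase
  have hsl_sk : Real.log ((s - l : ℤ) : ℝ) ≤ Real.log ((s + k : ℤ) : ℝ) :=
    Real.log_le_log hslr (by exact_mod_cast (by omega : s - l ≤ s + k))
  have hsl_s : Real.log ((s - l : ℤ) : ℝ) ≤ Real.log (s : ℝ) :=
    Real.log_le_log hslr (by exact_mod_cast (by omega : s - l ≤ s))
  have hsk_upper : Real.log ((s + k : ℤ) : ℝ) ≤ Real.log t + Real.log 2 := by
    rw [← Real.log_mul htr.ne' (by norm_num)]
    refine Real.log_le_log hskr ?_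
    have : ((s + k : ℤ) : ℝ) ≤ ((2 * t : ℤ) : ℝ) := by exact_mod_cast hb₂
    push_cast at this ⊢
    linarith
  have hkr : (0 : ℝ) ≤ k := by positivity
  have hlr : (0 : ℝ) ≤ l := by positivity
  have hψ_lower : (k + l : ℕ) * (Real.log t - Real.log 2) ≤ Real.log ψ := by
    rw [hlogψ, Nat.cast_add, add_comm (k : ℝ), add_mul]
    exact add_le_add (mul_le_mul_of_nonneg_left hsl_lower hlr)
      (mul_le_mul_of_nonneg_left (hsl_lower.trans hsl_sk) hkr)
  have hψ_upper : Real.log ψ ≤ (k + l : ℕ) * (Real.log t + Real.log 2) := by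
    rw [hlogψ, Nat.cast_add, add_comm (k : ℝ), add_mul]
    exact add_le_add (mul_le_mul_of_nonneg_left (hsl_sk.trans hsk_upper) hlr)
      (mul_le_mul_of_nonneg_left hsk_upper hkr)
  have hlogR : Real.log R ≤ (k + l : ℕ) * Real.log t - 2 * Real.log t +
      (k + l + 3 : ℕ) * Real.log 2 := by
    have h1 : ((s ^ 2 * R : ℤ) : ℝ) ≤ 2 * ψ := by
      rw [← hR]
      have : ((ψ - κ : ℤ) : ℝ) ≤ ((2 * ψ : ℤ) : ℝ) := by
        exact_mod_cast (by linarith [neg_abs_le κ] : ψ - κ ≤ 2 * ψ)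
      push_cast at this ⊢
      linarith
    have h2 := Real.log_le_log (by push_cast; positivity) h1
    push_cast at h2
    rw [Real.log_mul (by positivity) hRr.ne', Real.log_mul (by norm_num) hψr.ne',
      Real.log_pow] at h2
    have h3 : ((k + l + 3 : ℕ) : ℝ) = ((k + l : ℕ) : ℝ) + 3 := by push_cast; ring
    rw [h3]
    push_cast at h2
    linarith
  have hM : 0 < M₁ * M₂ * M₃ * R.toNat := by
    have : 0 < R.toNat := by omega
    positivity
  have hprime : ∀ p : ℕ, p.Prime → (p : ℤ) ∣ ψ * (ψ - κ) → p ∣ M₁ * M₂ * M₃ * R.toNat := by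
    intro p hp hd
    have hpz : Prime (p : ℤ) := Nat.prime_iff_prime_int.1 hp
    rw [hR, hψ] at hd
    rcases hpz.dvd_or_dvd hd with hd | hd
    · rcases hpz.dvd_or_dvd hd with hd | hd
      · have := hp₃ p hp (by
          have := hpz.dvd_of_dvd_pow hd
          rwa [hs, sub_sub] at this)
        exact Dvd.dvd.mul_right (Dvd.dvd.mul_left this _) _
      · have := hp₁ p hp (by
          have := hpz.dvd_of_dvd_pow hd
          rwa [hs, sub_add] at this)
        exact Dvd.dvd.mul_right (Dvd.dvd.mul_right (Dvd.dvd.mul_right this _) _) _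
    · rcases hpz.dvd_or_dvd hd with hd | hd
      · have := hp₂ p hp (hpz.dvd_of_dvd_pow hd)
        exact Dvd.dvd.mul_right (Dvd.dvd.mul_right (Dvd.dvd.mul_left this _) _) _
      · refine Dvd.dvd.mul_left ?_ _
        rw [← Int.natCast_dvd_natCast, Int.toNat_of_nonneg hRpos.le]
        exact hd
  have habcψ : Real.log ψ ≤
      (1 + ε) * (Real.log ((M₁ * M₂ * M₃ * R.toNat : ℕ) : ℝ) + Real.log κ.natAbs) + c := by
    have hcast : ∀ x : ℤ, 0 < x → ((x.toNat : ℕ) : ℝ) = (x : ℝ) := by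
      intro x hx
      have : ((x.toNat : ℤ) : ℝ) = (x : ℝ) := by rw [Int.toNat_of_nonneg hx.le]
      exact_mod_cast this
    have hprime' : ∀ p : ℕ, p.Prime → p ∣ ψ.toNat * (ψ - κ).toNat →
        p ∣ M₁ * M₂ * M₃ * R.toNat := by
      intro p hp hd
      refine hprime p hp ?_
      have := Int.natCast_dvd_natCast.2 hd
      rwa [Nat.cast_mul, Int.toNat_of_nonneg hψpos.le, Int.toNat_of_nonneg hψκpos.le] at this
    rcases lt_or_gt_of_ne hκ0 with hneg | hpos
    · have := hc ψ.toNat κ.natAbs (ψ - κ).toNat _ (by omega) (by omega) hM (by omega) hprime'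
      refine le_trans ?_ this
      rw [hcast _ hψκpos]
      exact Real.log_le_log hψr (by exact_mod_cast (by linarith : ψ ≤ ψ - κ))
    · have := hc (ψ - κ).toNat κ.natAbs ψ.toNat _ (by omega) (by omega) hM (by omega)
        (by simpa only [mul_comm (ψ - κ).toNat] using hprime')
      rwa [hcast _ hψpos] at this
  have hlogM : Real.log ((M₁ * M₂ * M₃ * R.toNat : ℕ) : ℝ) =
      Real.log M₁ + Real.log M₂ + Real.log M₃ + Real.log R := by
    have hRc : ((R.toNat : ℕ) : ℝ) = (R : ℝ) := by
      have : ((R.toNat : ℤ) : ℝ) = (R : ℝ) := by rw [Int.toNat_of_nonneg hRpos.le]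
      exact_mod_cast this
    push_cast
    rw [hRc, Real.log_mul (by positivity) hRr.ne', Real.log_mul (by positivity) (by positivity),
      Real.log_mul (by positivity) (by positivity)]
  rw [hlogM] at habcψ
  have hεD : ε * (k + l : ℕ) = δ := by rw [hεdef]; field_simp
  set L := Real.log t
  set S₀ := Real.log M₁ + Real.log M₂ + Real.log M₃
  have hL : 0 ≤ L := Real.log_nonneg (by exact_mod_cast htpos)
  set D : ℝ := ((k + l : ℕ) : ℝ)
  have hY : D * L ≤ (1 + ε) * (S₀ + C₁ + (D - 2) * L) + c₁ := by
    have h1 : D * (L - Real.log 2) ≤ (1 + ε) * (S₀ + C₁ + (D - 2) * L) + c := by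
      refine le_trans hψ_lower (le_trans habcψ ?_)
      have h4 : S₀ + Real.log R + Real.log κ.natAbs ≤ S₀ + C₁ + (D - 2) * L := by
        rw [hC₁]; linarith
      have := mul_le_mul_of_nonneg_left h4 (by positivity : 0 ≤ 1 + ε)
      linarith
    rw [hc₁]; linarith
  have hDL : 0 ≤ D * L := by positivity
  by_contra hcon
  push Not at hcon
  have h5 : S₀ + C₁ + (D - 2) * L < D * L - ε * (D * L) - c₁ := by
    have : ε * (D * L) = δ * L := by rw [← mul_assoc, hεD]
    linarith
  nlinarith [mul_nonneg hε.le hc₁0, mul_nonneg (mul_nonneg hε.le hε.le) hDL,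
    mul_lt_mul_of_pos_left h5 (by positivity : 0 < 1 + ε)]

theorem ABCConjecture.log_le_of_ne (habc : ABCConjecture) {z₁ z₂ z₃ : ℤ} (h₁₂ : z₁ ≠ z₂)
    (h₁₃ : z₁ ≠ z₃) (h₂₃ : z₂ ≠ z₃) {δ : ℝ} (hδ : 0 < δ) :
    ∃ (c : ℝ) (t₀ : ℕ), ∀ t : ℕ, t₀ ≤ t → ∀ M₁ M₂ M₃ : ℕ, 0 < M₁ → 0 < M₂ → 0 < M₃ →
      (∀ p : ℕ, p.Prime → (p : ℤ) ∣ t - z₁ → p ∣ M₁) →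
      (∀ p : ℕ, p.Prime → (p : ℤ) ∣ t - z₂ → p ∣ M₂) →
      (∀ p : ℕ, p.Prime → (p : ℤ) ∣ t - z₃ → p ∣ M₃) →
      2 * Real.log t ≤ Real.log M₁ + Real.log M₂ + Real.log M₃ + δ * Real.log t + c := by
  rcases lt_or_gt_of_ne h₁₂ with h | h <;> rcases lt_or_gt_of_ne h₁₃ with h' | h' <;>
    rcases lt_or_gt_of_ne h₂₃ with h'' | h''
  · exact habc.log_le_of_lt h h'' hδ
  · obtain ⟨c, t₀, H⟩ := habc.log_le_of_lt h' h'' hδ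
    refine ⟨c, t₀, fun t ht M₁ M₂ M₃ p₁ p₂ p₃ q₁ q₂ q₃ ↦ ?_⟩
    linarith [H t ht M₁ M₃ M₂ p₁ p₃ p₂ q₁ q₃ q₂]
  · omega
  · obtain ⟨c, t₀, H⟩ := habc.log_le_of_lt h' h hδ
    refine ⟨c, t₀, fun t ht M₁ M₂ M₃ p₁ p₂ p₃ q₁ q₂ q₃ ↦ ?_⟩
    linarith [H t ht M₃ M₁ M₂ p₃ p₁ p₂ q₃ q₁ q₂]
  · obtain ⟨c, t₀, H⟩ := habc.log_le_of_lt h h' hδ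
    refine ⟨c, t₀, fun t ht M₁ M₂ M₃ p₁ p₂ p₃ q₁ q₂ q₃ ↦ ?_⟩
    linarith [H t ht M₂ M₁ M₃ p₂ p₁ p₃ q₂ q₁ q₃]
  · omega
  · obtain ⟨c, t₀, H⟩ := habc.log_le_of_lt h'' h' hδ
    refine ⟨c, t₀, fun t ht M₁ M₂ M₃ p₁ p₂ p₃ q₁ q₂ q₃ ↦ ?_⟩
    linarith [H t ht M₂ M₃ M₁ p₂ p₃ p₁ q₂ q₃ q₁]
  · obtain ⟨c, t₀, H⟩ := habc.log_le_of_lt h'' h hδ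
    refine ⟨c, t₀, fun t ht M₁ M₂ M₃ p₁ p₂ p₃ q₁ q₂ q₃ ↦ ?_⟩
    linarith [H t ht M₃ M₂ M₁ p₃ p₂ p₁ q₃ q₂ q₁]

/-- Positive integers with `a ^ (x + m) + a ^ x = b ^ (y + n) + b ^ y`, where the leading powers
differ. -/
structure IsSolution (a b x m y n : ℕ) : Prop where
  one_lt_left : 1 < a
  one_lt_right : 1 < b
  x_pos : 0 < x
  m_pos : 0 < m
  y_pos : 0 < y
  n_pos : 0 < n
  ne : a ^ (x + m) ≠ b ^ (y + n)
  eq : a ^ (x + m) + a ^ x = b ^ (y + n) + b ^ y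

/-- A factorization of both sides of `a ^ x * (a ^ m + 1) = b ^ y * (b ^ n + 1)` into a common part
`g ^ x = h ^ y` with radical `R` and the parts `U ^ x`, `V ^ y`, `W`. -/
structure IsFactorization (a b x m y n g h U V W R : ℕ) : Prop where
  isSolution : IsSolution a b x m y n
  g_pos : 0 < g
  h_pos : 0 < h
  U_pos : 0 < U
  V_pos : 0 < V
  W_pos : 0 < W
  R_pos : 0 < R
  left_eq : a = g * U
  right_eq : b = h * V
  pow_eq : g ^ x = h ^ y
  left_add_one : a ^ m + 1 = V ^ y * W
  right_add_one : b ^ n + 1 = U ^ x * W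
  pow_ne : U ^ x ≠ V ^ y
  dvd_left : ∀ p : ℕ, p.Prime → p ∣ g → p ∣ R
  dvd_right : ∀ p : ℕ, p.Prime → p ∣ h → p ∣ R
  le_left : R ≤ g
  le_right : R ≤ h
  pow_le : R ^ Nat.lcm x y ≤ g ^ x

theorem IsSolution.symm {a b x m y n : ℕ} (h : IsSolution a b x m y n) :
    IsSolution b a y n x m :=
  ⟨h.one_lt_right, h.one_lt_left, h.y_pos, h.n_pos, h.x_pos, h.m_pos, h.ne.symm, h.eq.symm⟩

theorem IsSolution.mul_ne {a b x m y n : ℕ} (h : IsSolution a b x m y n) : x * n ≠ y * m := by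
  have key : ∀ {a b x m y n : ℕ}, IsSolution a b x m y n → x * n = y * m →
      ¬ a ^ (x + m) < b ^ (y + n) := by
    intro a b x m y n h hxy hlt
    have e1 : (a ^ (x + m)) ^ (x * (y + n)) = (a ^ x) ^ ((x + m) * (y + n)) := by
      rw [← pow_mul, ← pow_mul]; congr 1; ring
    have e2 : (b ^ (y + n)) ^ (x * (y + n)) = (b ^ y) ^ ((x + m) * (y + n)) := by
      rw [← pow_mul, ← pow_mul]; congr 1
      linear_combination (y + n) * hxy
    have hx := h.x_pos
    have hy := h.y_pos
    have h1 : (a ^ x) ^ ((x + m) * (y + n)) < (b ^ y) ^ ((x + m) * (y + n)) := by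
      rw [← e1, ← e2]
      exact Nat.pow_lt_pow_left hlt (by positivity)
    have h2 : a ^ x < b ^ y := lt_of_pow_lt_pow_left₀ _ (by positivity) h1
    have := h.eq
    omega
  intro hxy
  rcases lt_or_gt_of_ne h.ne with hlt | hlt
  · exact key h hxy hlt
  · exact key h.symm hxy.symm hlt

theorem IsFactorization.symm {a b x m y n g h U V W R : ℕ}
    (H : IsFactorization a b x m y n g h U V W R) : IsFactorization b a y n x m h g V U W R :=
  ⟨H.isSolution.symm, H.h_pos, H.g_pos, H.V_pos, H.U_pos, H.W_pos, H.R_pos, H.right_eq, H.left_eq,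
    H.pow_eq.symm, H.right_add_one, H.left_add_one, H.pow_ne.symm, H.dvd_right, H.dvd_left,
    H.le_right, H.le_left, by rw [Nat.lcm_comm, ← H.pow_eq]; exact H.pow_le⟩

theorem prod_primeFactors_pow_lcm_le {g h x y : ℕ} (hg : 0 < g) (hgh : g ^ x = h ^ y) :
    (∏ p ∈ (g ^ x).primeFactors, p) ^ Nat.lcm x y ≤ g ^ x := by
  have hpos : 0 < g ^ x := by positivity
  conv_rhs => rw [← Nat.prod_factorization_pow_eq_self hpos.ne']
  rw [← Finset.prod_pow, Finsupp.prod, Nat.support_factorization]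
  refine Finset.prod_le_prod' fun p hp ↦ ?_
  have hpp := Nat.prime_of_mem_primeFactors hp
  refine Nat.pow_le_pow_right hpp.pos (Nat.le_of_dvd ?_ (Nat.lcm_dvd ?_ ?_))
  · exact hpp.factorization_pos_of_dvd hpos.ne' (Nat.dvd_of_mem_primeFactors hp)
  · rw [Nat.factorization_pow]; simp
  · rw [hgh, Nat.factorization_pow]; simp

theorem IsSolution.exists_isFactorization {a b x m y n : ℕ} (H : IsSolution a b x m y n) :
    ∃ g h U V W R : ℕ, IsFactorization a b x m y n g h U V W R := by
  have ha : 0 < a := by have := H.one_lt_left; omega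
  have hb : 0 < b := by have := H.one_lt_right; omega
  have hx := H.x_pos
  have hy := H.y_pos
  have hax : 0 < a ^ x := by positivity
  have hby : 0 < b ^ y := by positivity
  obtain ⟨G, α, β, hG, hco, hα, hβ⟩ := Nat.exists_coprime' (Nat.gcd_pos_of_pos_left (b ^ y) hax)
  have hmul : α * (a ^ m + 1) = β * (b ^ n + 1) := by
    have h1 : a ^ x * (a ^ m + 1) = b ^ y * (b ^ n + 1) := by
      have := H.eq
      rw [pow_add, pow_add] at this
      linarith
    rw [hα, hβ] at h1
    refine Nat.eq_of_mul_eq_mul_right hG ?_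
    linarith
  obtain ⟨W, hW⟩ : β ∣ a ^ m + 1 := hco.symm.dvd_of_dvd_mul_left ⟨_, hmul⟩
  have hα0 : 0 < α := Nat.pos_of_ne_zero (by rintro rfl; omega)
  have hβ0 : 0 < β := Nat.pos_of_ne_zero (by rintro rfl; omega)
  have hW' : b ^ n + 1 = α * W := by
    rw [hW] at hmul
    refine Nat.eq_of_mul_eq_mul_left hβ0 ?_
    linarith
  have hW0 : 0 < W := Nat.pos_of_ne_zero (by rintro rfl; omega)
  have hcop : ∀ c k : ℕ, 0 < k → Nat.Coprime (c ^ k + 1) c := by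
    intro c k hk
    obtain ⟨j, rfl⟩ : ∃ j, k = j + 1 := ⟨k - 1, by omega⟩
    rw [pow_succ]
    simp
  have hGa : G ∣ a ^ x := ⟨α, by rw [hα, mul_comm]⟩
  have hGb : G ∣ b ^ y := ⟨β, by rw [hβ, mul_comm]⟩
  have hαG : Nat.Coprime α G :=
    ((hcop b n H.n_pos).coprime_dvd_left ⟨W, hW'⟩).pow_right y |>.coprime_dvd_right hGb
  have hβG : Nat.Coprime β G :=
    ((hcop a m H.m_pos).coprime_dvd_left ⟨W, hW⟩).pow_right x |>.coprime_dvd_right hGa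
  obtain ⟨U, hU⟩ := exists_eq_pow_of_mul_eq_pow (Nat.isUnit_iff.2 hαG) hα.symm
  obtain ⟨g, hg⟩ := exists_eq_pow_of_mul_eq_pow (Nat.isUnit_iff.2 hαG.symm)
    ((mul_comm G α).trans hα.symm)
  obtain ⟨V, hV⟩ := exists_eq_pow_of_mul_eq_pow (Nat.isUnit_iff.2 hβG) hβ.symm
  obtain ⟨h, hh⟩ := exists_eq_pow_of_mul_eq_pow (Nat.isUnit_iff.2 hβG.symm)
    ((mul_comm G β).trans hβ.symm)
  have pos_of : ∀ {c d k : ℕ}, 0 < k → 0 < d → d = c ^ k → 0 < c := by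
    intro c d k hk hd hc
    refine Nat.pos_of_ne_zero ?_
    rintro rfl
    rw [zero_pow hk.ne'] at hc
    omega
  have hg0 := pos_of hx hG hg
  have hh0 := pos_of hy hG hh
  have hpow : g ^ x = h ^ y := hg.symm.trans hh
  have hpf : (g ^ x).primeFactors = g.primeFactors := Nat.primeFactors_pow g hx.ne'
  have hpf' : (g ^ x).primeFactors = h.primeFactors := by
    rw [hpow]; exact Nat.primeFactors_pow h hy.ne'
  refine ⟨g, h, U, V, W, ∏ p ∈ (g ^ x).primeFactors, p, ⟨H, hg0, hh0, pos_of hx hα0 hU,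
    pos_of hy hβ0 hV, hW0, ?_, ?_, ?_, hpow, by rw [hW, hV], by rw [hW', hU], ?_, ?_, ?_, ?_, ?_,
    prod_primeFactors_pow_lcm_le hg0 hpow⟩⟩
  · exact Finset.prod_pos fun p hp ↦ Nat.pos_of_mem_primeFactors hp
  · refine Nat.pow_left_injective hx.ne' ?_
    simp only [mul_pow]
    rw [hα, hU, hg, mul_comm]
  · refine Nat.pow_left_injective hy.ne' ?_
    simp only [mul_pow]
    rw [hβ, hV, hh, mul_comm]
  · rw [← hU, ← hV]
    rintro rfl
    apply H.ne
    have := H.eq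
    rw [hα, hβ] at this
    omega
  · intro p hp hd
    rw [hpf]
    exact Finset.dvd_prod_of_mem _ (Nat.mem_primeFactors.2 ⟨hp, hd, hg0.ne'⟩)
  · intro p hp hd
    rw [hpf']
    exact Finset.dvd_prod_of_mem _ (Nat.mem_primeFactors.2 ⟨hp, hd, hh0.ne'⟩)
  · rw [hpf]
    exact Nat.le_of_dvd hg0 (Nat.prod_primeFactors_dvd _)
  · rw [hpf']
    exact Nat.le_of_dvd hh0 (Nat.prod_primeFactors_dvd _)

namespace IsFactorization

variable {a b x m y n g h U V W R : ℕ}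

theorem log_left (H : IsFactorization a b x m y n g h U V W R) :
    Real.log a = Real.log g + Real.log U := by
  have hg := H.g_pos
  have hU := H.U_pos
  rw [H.left_eq, Nat.cast_mul, Real.log_mul (by positivity) (by positivity)]

theorem mul_log_eq (H : IsFactorization a b x m y n g h U V W R) :
    x * Real.log g = y * Real.log h := by
  rw [← Real.log_pow, ← Real.log_pow]
  exact_mod_cast congrArg (fun k : ℕ ↦ Real.log k) H.pow_eq

theorem log_left_add_one (H : IsFactorization a b x m y n g h U V W R) :
    Real.log (a ^ m + 1 : ℕ) = y * Real.log V + Real.log W := by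
  have hV := H.V_pos
  have hW := H.W_pos
  rw [H.left_add_one, Nat.cast_mul, Real.log_mul (by positivity) (by positivity), Nat.cast_pow,
    Real.log_pow]

theorem mul_log_left_le (H : IsFactorization a b x m y n g h U V W R) :
    m * Real.log a ≤ y * Real.log V + Real.log W := by
  have ha := H.isSolution.one_lt_left
  rw [← H.log_left_add_one, ← Real.log_pow]
  refine Real.log_le_log (by positivity) ?_
  push_cast
  linarith

theorem le_mul_log_left (H : IsFactorization a b x m y n g h U V W R) :
    y * Real.log V + Real.log W ≤ m * Real.log a + Real.log 2 := by
  have ha : 1 < (a : ℝ) := by exact_mod_cast H.isSolution.one_lt_left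
  have h1 : 1 ≤ (a : ℝ) ^ m := one_le_pow₀ ha.le
  rw [← H.log_left_add_one, ← Real.log_pow, ← Real.log_mul (by positivity) (by norm_num)]
  refine Real.log_le_log (by positivity) ?_
  push_cast
  linarith

theorem log_radical_le (H : IsFactorization a b x m y n g h U V W R) :
    Real.log R ≤ Real.log g := by
  have hR := H.R_pos
  exact Real.log_le_log (by positivity) (by exact_mod_cast H.le_left)

theorem lcm_mul_log_radical_le (H : IsFactorization a b x m y n g h U V W R) :
    Nat.lcm x y * Real.log R ≤ x * Real.log g := by
  have hR := H.R_pos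
  rw [← Real.log_pow, ← Real.log_pow]
  exact Real.log_le_log (by positivity) (by exact_mod_cast H.pow_le)

theorem log_sum (H : IsFactorization a b x m y n g h U V W R) :
    Real.log (a ^ (x + m) + a ^ x : ℕ) =
      x * Real.log g + x * Real.log U + (y * Real.log V + Real.log W) := by
  have ha := H.isSolution.one_lt_left
  rw [← mul_add, ← H.log_left, ← H.log_left_add_one, ← Real.log_pow, ← Nat.cast_pow,
    ← Real.log_mul (by positivity) (by positivity), ← Nat.cast_mul]
  congr 2
  ring

theorem pow_mul_eq (H : IsFactorization a b x m y n g h U V W R) :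
    U ^ x * a ^ m + U ^ x = V ^ y * b ^ n + V ^ y := by
  have h1 := H.left_add_one
  have h2 := H.right_add_one
  calc U ^ x * a ^ m + U ^ x = U ^ x * (a ^ m + 1) := by ring
    _ = V ^ y * (b ^ n + 1) := by rw [h1, h2]; ring
    _ = _ := by ring

theorem dvd_mul_of_dvd_left (H : IsFactorization a b x m y n g h U V W R) {p : ℕ} (hp : p.Prime)
    (hd : p ∣ a) : p ∣ R * U := by
  rw [H.left_eq] at hd
  rcases hp.dvd_mul.1 hd with hd | hd
  · exact Dvd.dvd.mul_right (H.dvd_left p hp hd) _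
  · exact Dvd.dvd.mul_left hd _

theorem dvd_mul_of_dvd_sum (H : IsFactorization a b x m y n g h U V W R) {p : ℕ} (hp : p.Prime)
    (hd : p ∣ a ^ (x + m) + a ^ x) : p ∣ R * U * V * W := by
  have : a ^ (x + m) + a ^ x = a ^ x * (V ^ y * W) := by rw [← H.left_add_one]; ring
  rw [this] at hd
  rcases hp.dvd_mul.1 hd with hd | hd
  · exact Dvd.dvd.mul_right (Dvd.dvd.mul_right
      (H.dvd_mul_of_dvd_left hp (hp.dvd_of_dvd_pow hd)) _) _
  · rcases hp.dvd_mul.1 hd with hd | hd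
    · exact Dvd.dvd.mul_right (Dvd.dvd.mul_left (hp.dvd_of_dvd_pow hd) _) _
    · exact Dvd.dvd.mul_left hd _

theorem log_mul_radical (H : IsFactorization a b x m y n g h U V W R) :
    Real.log (R * U * V : ℕ) = Real.log R + Real.log U + Real.log V := by
  have hU := H.U_pos
  have hV := H.V_pos
  have hR := H.R_pos
  push_cast
  rw [Real.log_mul (by positivity) (by positivity), Real.log_mul (by positivity) (by positivity)]

theorem log_mul_radical' (H : IsFactorization a b x m y n g h U V W R) :
    Real.log (R * U * V * W : ℕ) = Real.log R + Real.log U + Real.log V + Real.log W := by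
  have hW := H.W_pos
  have hU := H.U_pos
  have hV := H.V_pos
  have hR := H.R_pos
  rw [Nat.cast_mul, Real.log_mul (by positivity) (by positivity), H.log_mul_radical]

end IsFactorization

theorem ABCConjecture.left_add_one_le (habc : ABCConjecture) {ε : ℝ} (hε : 0 < ε) :
    ∃ c : ℝ, 0 ≤ c ∧ ∀ {a b x m y n g h U V W R : ℕ}, IsFactorization a b x m y n g h U V W R →
      y * Real.log V + Real.log W ≤
        (1 + ε) * (Real.log R + Real.log U + Real.log V + Real.log W) + c := by
  obtain ⟨c, hc0, hc⟩ := habc.log_le hε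
  refine ⟨c, hc0, fun {a b x m y n g h U V W R} H ↦ ?_⟩
  have ha := H.isSolution.one_lt_left
  have hM : 0 < R * U * V * W := by
    have hW := H.W_pos
    have hU := H.U_pos
    have hV := H.V_pos
    have hR := H.R_pos
    positivity
  have := hc (a ^ m) 1 (a ^ m + 1) (R * U * V * W) (by positivity) one_pos hM rfl ?_
  · rwa [H.log_left_add_one, H.log_mul_radical', Nat.cast_one, Real.log_one, add_zero] at this
  · intro p hp hd
    refine H.dvd_mul_of_dvd_sum hp ?_
    have e : a ^ (x + m) + a ^ x = a ^ x * (a ^ m + 1) := by ring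
    rw [e]
    rcases hp.dvd_mul.1 hd with hd | hd
    · exact Dvd.dvd.mul_right ((hp.dvd_of_dvd_pow hd).trans
        (dvd_pow_self a H.isSolution.x_pos.ne')) _
    · exact Dvd.dvd.mul_left hd _

theorem ABCConjecture.sub_le (habc : ABCConjecture) {ε : ℝ} (hε : 0 < ε) :
    ∃ c : ℝ, 0 ≤ c ∧ ∀ {a b x m y n g h U V W R : ℕ}, IsFactorization a b x m y n g h U V W R →
      U ^ x < V ^ y → x * Real.log U + y * Real.log V + Real.log W ≤
        (1 + ε) * (Real.log R + Real.log U + Real.log V + y * Real.log V) + c := by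
  obtain ⟨c, hc0, hc⟩ := habc.log_le hε
  refine ⟨c + Real.log 2, by positivity, fun {a b x m y n g h U V W R} H hlt ↦ ?_⟩
  have ha := H.isSolution.one_lt_left
  have hb := H.isSolution.one_lt_right
  have hU := H.U_pos
  have hV := H.V_pos
  have hR := H.R_pos
  have hW := H.W_pos
  have := hc (V ^ y * b ^ n) (V ^ y - U ^ x) (U ^ x * a ^ m) (R * U * V) (by positivity)
    (by omega) (by positivity) (by have := H.pow_mul_eq; omega) ?_
  · have h1 : Real.log (V ^ y - U ^ x : ℕ) ≤ y * Real.log V := by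
      rw [← Real.log_pow, ← Nat.cast_pow]
      exact Real.log_le_log (by exact_mod_cast (by omega : 0 < V ^ y - U ^ x))
        (by exact_mod_cast (by omega : V ^ y - U ^ x ≤ V ^ y))
    have h2 : Real.log (U ^ x * a ^ m : ℕ) = x * Real.log U + m * Real.log a := by
      push_cast
      rw [Real.log_mul (by positivity) (by positivity), Real.log_pow, Real.log_pow]
    have h3 := H.le_mul_log_left
    rw [h2, H.log_mul_radical] at this
    have h4 := mul_le_mul_of_nonneg_left h1 (by positivity : 0 ≤ 1 + ε)
    linarith
  · intro p hp hd
    have hleft : p ∣ a → p ∣ R * U * V := fun hd ↦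
      Dvd.dvd.mul_right (H.dvd_mul_of_dvd_left hp hd) _
    have hright : p ∣ b → p ∣ R * U * V := fun hd ↦ by
      rw [mul_right_comm]
      exact Dvd.dvd.mul_right (H.symm.dvd_mul_of_dvd_left hp hd) _
    rcases hp.dvd_mul.1 hd with hd | hd
    · rcases hp.dvd_mul.1 hd with hd | hd
      · exact Dvd.dvd.mul_left (hp.dvd_of_dvd_pow hd) _
      · exact hright (hp.dvd_of_dvd_pow hd)
    · rcases hp.dvd_mul.1 hd with hd | hd
      · exact Dvd.dvd.mul_right (Dvd.dvd.mul_left (hp.dvd_of_dvd_pow hd) _) _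
      · exact hleft (hp.dvd_of_dvd_pow hd)

theorem ABCConjecture.sq_le (habc : ABCConjecture) {ε : ℝ} (hε : 0 < ε) :
    ∃ c : ℝ, 0 ≤ c ∧ ∀ {a b x m : ℕ}, IsSolution a b x m 1 1 →
      2 * Real.log (2 * b + 1 : ℕ) ≤ (1 + ε) * (Real.log (2 * a : ℕ) + Real.log (2 * b + 1 : ℕ) +
        Real.log (4 * a ^ x + 1 : ℕ)) + c := by
  obtain ⟨c, hc0, hc⟩ := habc.log_le hε
  refine ⟨c, hc0, fun {a b x m} H ↦ ?_⟩
  have ha := H.one_lt_left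
  have heq := H.eq
  have := hc (4 * a ^ (x + m)) (4 * a ^ x + 1) ((2 * b + 1) ^ 2) (2 * a * (2 * b + 1))
    (by positivity) (by positivity) (by positivity) (by linear_combination 4 * heq) ?_
  · rw [Nat.cast_pow, Real.log_pow, Nat.cast_mul (2 * a), Real.log_mul (by positivity)
      (by positivity)] at this
    exact_mod_cast this
  · intro p hp hd
    rcases hp.dvd_mul.1 hd with hd | hd
    · rcases hp.dvd_mul.1 hd with hd | hd
      · have h2 : p ∣ 2 := hp.dvd_of_dvd_pow (by norm_num; exact hd : p ∣ 2 ^ 2)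
        exact Dvd.dvd.mul_right (Dvd.dvd.mul_right h2 _) _
      · exact Dvd.dvd.mul_right (Dvd.dvd.mul_left (hp.dvd_of_dvd_pow hd) _) _
    · exact Dvd.dvd.mul_left (hp.dvd_of_dvd_pow hd) _

theorem exists_radical_of_sq_dvd_sub {t s : ℕ} {e : ℤ} (hs : 0 < s) (hd : (s : ℤ) ^ 2 ∣ t - e)
    (he : |e| < t) : ∃ M : ℕ, 0 < M ∧ (∀ p : ℕ, p.Prime → (p : ℤ) ∣ t - e → p ∣ M) ∧
      Real.log M ≤ Real.log 2 + Real.log t - Real.log s := by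
  obtain ⟨Q, hQ⟩ := hd
  have ht : 0 < t := by have := abs_nonneg e; omega
  have hne : (t : ℤ) - e ≠ 0 := by have := le_abs_self e; omega
  have hM : 0 < (s * Q).natAbs := by
    refine Int.natAbs_pos.2 fun h0 ↦ hne ?_
    rw [hQ, sq, mul_assoc, h0, mul_zero]
  refine ⟨(s * Q).natAbs, hM, fun p hp hpd ↦ ?_, ?_⟩
  · have hpz : Prime (p : ℤ) := Nat.prime_iff_prime_int.1 hp
    rw [← Int.natCast_dvd]
    rw [hQ] at hpd
    rcases hpz.dvd_or_dvd hpd with hpd | hpd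
    · exact Dvd.dvd.mul_right (hpz.dvd_of_dvd_pow hpd) _
    · exact Dvd.dvd.mul_left hpd _
  · have h1 : s * (s * Q).natAbs ≤ 2 * t := by
      have : s * (s * Q).natAbs = ((t : ℤ) - e).natAbs := by
        rw [hQ, sq, mul_assoc, Int.natAbs_mul (s : ℤ) ((s : ℤ) * Q), Int.natAbs_natCast]
      rw [this]
      have h := neg_abs_le e
      have h' := le_abs_self e
      omega
    have hM' : (0 : ℝ) < ((s * Q).natAbs : ℝ) := by exact_mod_cast hM
    have h2 : ((s * (s * Q).natAbs : ℕ) : ℝ) ≤ ((2 * t : ℕ) : ℝ) := by exact_mod_cast h1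
    have h3 := Real.log_le_log (by push_cast; positivity) h2
    rw [Nat.cast_mul, Nat.cast_mul, Real.log_mul (by positivity) hM'.ne',
      Real.log_mul (by norm_num) (by positivity), Nat.cast_ofNat] at h3
    linarith

theorem mul_log_critical_lt {x m y n : ℕ} (hx : 0 < x) (hm : 0 < m) (hy : 0 < y) (hn : 0 < n)
    (h : x * n < y * m) :
    m * (y * Real.log y + n * Real.log n - (y + n) * Real.log (y + n)) <
      n * (x * Real.log x + m * Real.log m - (x + m) * Real.log (x + m)) := by
  have hx' : (0 : ℝ) < x := by positivity
  have hm' : (0 : ℝ) < m := by positivity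
  have hy' : (0 : ℝ) < y := by positivity
  have hn' : (0 : ℝ) < n := by positivity
  have h' : (x : ℝ) * n < y * m := by exact_mod_cast h
  have h1 := Real.log_le_sub_one_of_pos
    (show (0 : ℝ) < (y / (y + n)) / (x / (x + m)) by positivity)
  have h2 := Real.log_le_sub_one_of_pos
    (show (0 : ℝ) < (n / (y + n)) / (m / (x + m)) by positivity)
  rw [Real.log_div (by positivity) (by positivity), Real.log_div (by positivity) (by positivity),
    Real.log_div (by positivity) (by positivity)] at h1 h2
  have h3 : (x : ℝ) * ((y / (y + n)) / (x / (x + m)) - 1) +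
      m * ((n / (y + n)) / (m / (x + m)) - 1) = 0 := by
    field_simp
    ring
  have h4 : Real.log y - Real.log (y + n) < 0 :=
    sub_neg.2 (Real.log_lt_log hy' (by linarith))
  have h5 := mul_le_mul_of_nonneg_left h1 hx'.le
  have h6 := mul_le_mul_of_nonneg_left h2 hm'.le
  have h7 := mul_lt_mul_of_neg_right h' h4
  have h8 : n * (x * (Real.log y - Real.log (y + n) - (Real.log x - Real.log (x + m))) +
    m * (Real.log n - Real.log (y + n) - (Real.log m - Real.log (x + m)))) ≤ 0 :=
    mul_nonpos_of_nonneg_of_nonpos hn'.le (by linarith)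
  linarith

theorem critical_values_ne {x m y n : ℕ} (hx : 0 < x) (hm : 0 < m) (hy : 0 < y) (hn : 0 < n)
    (h : x * n ≠ y * m) :
    ((-(x : ℤ)) ^ x * (m : ℤ) ^ m) ^ n * (((y + n : ℕ) : ℤ) ^ (y + n)) ^ m ≠
      ((-(y : ℤ)) ^ y * (n : ℤ) ^ n) ^ m * (((x + m : ℕ) : ℤ) ^ (x + m)) ^ n := by
  intro heq
  have h1 := congrArg (fun k : ℤ ↦ Real.log (k.natAbs : ℕ)) heq
  simp only [Int.natAbs_mul, Int.natAbs_pow, Int.natAbs_neg, Int.natAbs_natCast, Nat.cast_mul,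
    Nat.cast_pow] at h1
  rw [Real.log_mul (by positivity) (by positivity), Real.log_mul (by positivity) (by positivity)]
    at h1
  simp only [Real.log_pow] at h1
  rw [Real.log_mul (by positivity) (by positivity), Real.log_mul (by positivity) (by positivity)]
    at h1
  simp only [Real.log_pow] at h1
  push_cast at h1
  rcases lt_or_gt_of_ne h with h | h
  · have := mul_log_critical_lt hx hm hy hn h
    linarith
  · have := mul_log_critical_lt hy hn hx hm h
    linarith

theorem sq_dvd_sub_critical {a x m : ℕ} (hx : 0 < x) (hm : 0 < m) :
    (((x + m) * a ^ m + x : ℕ) : ℤ) ^ 2 ∣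
      ((x + m : ℕ) : ℤ) ^ (x + m) * ((a ^ (x + m) + a ^ x : ℕ) : ℤ) ^ m -
        (-(x : ℤ)) ^ x * (m : ℤ) ^ m := by
  convert sq_dvd_belyi (((x + m) * a ^ m + x : ℕ) : ℤ) hx hm using 2
  have h1 : (((x + m) * a ^ m + x : ℕ) : ℤ) - x = (x + m) * (a : ℤ) ^ m := by push_cast; ring
  have h2 : (((x + m) * a ^ m + x : ℕ) : ℤ) + m = (x + m) * ((a : ℤ) ^ m + 1) := by
    push_cast; ring
  have h3 : ((a ^ (x + m) + a ^ x : ℕ) : ℤ) = (a : ℤ) ^ x * ((a : ℤ) ^ m + 1) := by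
    push_cast; ring
  rw [h1, h2, h3]
  push_cast
  simp only [mul_pow, pow_add, ← pow_mul]
  rw [mul_comm x m]
  ring

theorem ABCConjecture.mul_log_add_mul_log_le (habc : ABCConjecture) {x m y n : ℕ} (hx : 0 < x)
    (hm : 0 < m) (hy : 0 < y) (hn : 0 < n) (hne : x * n ≠ y * m) {δ : ℝ} (hδ : 0 < δ) :
    ∃ c : ℝ, 0 ≤ c ∧ ∀ {a b g h U V W R : ℕ}, IsFactorization a b x m y n g h U V W R →
      m * Real.log a + n * Real.log b ≤ Real.log R + Real.log U + Real.log V + Real.log W +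
        δ * Real.log (a ^ (x + m) + a ^ x : ℕ) + c := by
  set X : ℕ := (x + m) ^ (x + m) with hX
  set Y : ℕ := (y + n) ^ (y + n) with hY
  set κ : ℤ := (-(x : ℤ)) ^ x * (m : ℤ) ^ m with hκ
  set κ' : ℤ := (-(y : ℤ)) ^ y * (n : ℤ) ^ n with hκ'
  have hX0 : 0 < X := by positivity
  have hY0 : 0 < Y := by positivity
  have hκ0 : κ ≠ 0 := mul_ne_zero (pow_ne_zero _ (neg_ne_zero.2 (by positivity))) (by positivity)
  have hκ0' : κ' ≠ 0 :=
    mul_ne_zero (pow_ne_zero _ (neg_ne_zero.2 (by positivity))) (by positivity)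
  set e₁ : ℤ := κ ^ n * (Y : ℤ) ^ m with he₁
  set e₂ : ℤ := κ' ^ m * (X : ℤ) ^ n with he₂
  have he : e₁ ≠ e₂ := by
    have := critical_values_ne hx hm hy hn hne
    rw [he₁, he₂, hX, hY]
    push_cast at this ⊢
    exact this
  have he₁0 : (0 : ℤ) ≠ e₁ := (mul_ne_zero (pow_ne_zero _ hκ0) (by positivity)).symm
  have he₂0 : (0 : ℤ) ≠ e₂ := (mul_ne_zero (pow_ne_zero _ hκ0') (by positivity)).symm
  set D : ℝ := ((m * n : ℕ) : ℝ) with hD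
  have hD0 : 0 < D := by positivity
  obtain ⟨c, t₀, hc⟩ := habc.log_le_of_ne he₁0 he₂0 he (δ := δ / D) (by positivity)
  set Λ : ℕ := X ^ n * Y ^ m with hΛ
  have hΛ0 : 0 < Λ := by positivity
  set t₁ : ℕ := t₀ + e₁.natAbs + e₂.natAbs + 1 with ht₁
  have hlog2 : 0 < Real.log 2 := Real.log_pos (by norm_num)
  have hlogΛ : 0 ≤ Real.log Λ := Real.log_natCast_nonneg _
  have hlogt₁ : 0 ≤ Real.log t₁ := Real.log_natCast_nonneg _
  refine ⟨|c| + 2 * Real.log 2 + Real.log Λ + δ / D * Real.log Λ + 2 * Real.log t₁ +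
    2 * Real.log 2, by positivity, ?_⟩
  intro a b g h U V W R H
  have ha := H.isSolution.one_lt_left
  have hb := H.isSolution.one_lt_right
  set N : ℕ := a ^ (x + m) + a ^ x with hN
  have hN0 : 0 < N := by positivity
  have hlogN : 0 ≤ Real.log N := Real.log_natCast_nonneg _
  have hlr : 0 ≤ Real.log R := Real.log_natCast_nonneg _
  have hlU : 0 ≤ Real.log U := Real.log_natCast_nonneg _
  have hlV : 0 ≤ Real.log V := Real.log_natCast_nonneg _
  have hlW : 0 ≤ Real.log W := Real.log_natCast_nonneg _
  by_cases hNt : N < t₁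
  · have hle : Real.log N ≤ Real.log t₁ :=
      Real.log_le_log (by positivity) (by exact_mod_cast hNt.le)
    have hxg : 0 ≤ (x : ℝ) * Real.log g := mul_nonneg (by positivity) (Real.log_natCast_nonneg _)
    have hxU : 0 ≤ (x : ℝ) * Real.log U := by positivity
    have hyV : 0 ≤ (y : ℝ) * Real.log V := by positivity
    have h1 := H.mul_log_left_le
    have h2 := H.symm.mul_log_left_le
    have h3 := H.log_sum
    have h4 : 0 ≤ δ * Real.log N := by positivity
    have h5 : 0 ≤ δ / D * Real.log Λ := by positivity
    have h6 := abs_nonneg c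
    linarith
  · push Not at hNt
    set t : ℕ := Λ * N ^ (m * n) with ht
    have htN : N ≤ t := by
      calc N ≤ N ^ (m * n) := Nat.le_self_pow (by positivity) _
        _ ≤ t := Nat.le_mul_of_pos_left _ hΛ0
    have hlogt : Real.log t = Real.log Λ + D * Real.log N := by
      rw [ht, Nat.cast_mul, Real.log_mul (by positivity) (by positivity), Nat.cast_pow,
        Real.log_pow]
    have hM₁ : 0 < Λ * (R * U * V * W) := by
      have hW := H.W_pos
      have hU := H.U_pos
      have hV := H.V_pos
      have hR := H.R_pos
      positivity
    have hd₁ : (((x + m) * a ^ m + x : ℕ) : ℤ) ^ 2 ∣ (t : ℤ) - e₁ := by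
      have h1 : (((x + m) * a ^ m + x : ℕ) : ℤ) ^ 2 ∣ (X : ℤ) * (N : ℤ) ^ m - κ := by
        have := sq_dvd_sub_critical (a := a) hx hm
        rw [hX, hN, hκ]
        push_cast at this ⊢
        exact this
      have h2 : (t : ℤ) - e₁ = (Y : ℤ) ^ m * (((X : ℤ) * (N : ℤ) ^ m) ^ n - κ ^ n) := by
        rw [ht, hΛ, he₁]
        push_cast
        rw [mul_pow (X : ℤ) ((N : ℤ) ^ m) n, ← pow_mul (N : ℤ) m n]
        ring
      rw [h2]
      exact Dvd.dvd.mul_left (h1.trans (sub_dvd_pow_sub_pow _ _ n)) _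
    have hd₂ : (((y + n) * b ^ n + y : ℕ) : ℤ) ^ 2 ∣ (t : ℤ) - e₂ := by
      have h1 : (((y + n) * b ^ n + y : ℕ) : ℤ) ^ 2 ∣ (Y : ℤ) * (N : ℤ) ^ n - κ' := by
        have := sq_dvd_sub_critical (a := b) hy hn
        rw [hY, hN, hκ', H.isSolution.eq]
        push_cast at this ⊢
        exact this
      have h2 : (t : ℤ) - e₂ = (X : ℤ) ^ n * (((Y : ℤ) * (N : ℤ) ^ n) ^ m - κ' ^ m) := by
        rw [ht, hΛ, he₂]
        push_cast
        rw [mul_pow (Y : ℤ) ((N : ℤ) ^ n) m, ← pow_mul (N : ℤ) n m, mul_comm n m]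
        ring
      rw [h2]
      exact Dvd.dvd.mul_left (h1.trans (sub_dvd_pow_sub_pow _ _ m)) _
    obtain ⟨M₂, hM₂, hp₂, hl₂⟩ := exists_radical_of_sq_dvd_sub (by positivity) hd₁
      (by rw [Int.abs_eq_natAbs]; omega)
    obtain ⟨M₃, hM₃, hp₃, hl₃⟩ := exists_radical_of_sq_dvd_sub (by positivity) hd₂
      (by rw [Int.abs_eq_natAbs]; omega)
    have hp₁ : ∀ p : ℕ, p.Prime → (p : ℤ) ∣ t - 0 → p ∣ Λ * (R * U * V * W) := by
      intro p hp hd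
      rw [sub_zero, Int.natCast_dvd_natCast, ht] at hd
      rcases hp.dvd_mul.1 hd with hd | hd
      · exact Dvd.dvd.mul_right hd _
      · exact Dvd.dvd.mul_left (H.dvd_mul_of_dvd_sum hp (hp.dvd_of_dvd_pow hd)) _
    have key := hc t (by omega) _ M₂ M₃ hM₁ hM₂ hM₃ hp₁ hp₂ hp₃
    have hlogM₁ : Real.log (Λ * (R * U * V * W) : ℕ) =
        Real.log Λ + (Real.log R + Real.log U + Real.log V + Real.log W) := by
      have hpos : 0 < R * U * V * W := Nat.pos_of_mul_pos_left hM₁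
      rw [Nat.cast_mul, Real.log_mul (by positivity) (by positivity), H.log_mul_radical']
    have hs₁ : m * Real.log a ≤ Real.log ((x + m) * a ^ m + x : ℕ) := by
      rw [← Real.log_pow, ← Nat.cast_pow]
      refine Real.log_le_log (by positivity) (Nat.cast_le.2 ?_)
      have : a ^ m ≤ (x + m) * a ^ m := Nat.le_mul_of_pos_left _ (by omega)
      omega
    have hs₂ : n * Real.log b ≤ Real.log ((y + n) * b ^ n + y : ℕ) := by
      rw [← Real.log_pow, ← Nat.cast_pow]
      refine Real.log_le_log (by positivity) (Nat.cast_le.2 ?_)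
      have : b ^ n ≤ (y + n) * b ^ n := Nat.le_mul_of_pos_left _ (by omega)
      omega
    have hδD : δ / D * Real.log t = δ / D * Real.log Λ + δ * Real.log N := by
      rw [hlogt]; field_simp
    rw [hlogM₁, hδD] at key
    have h6 := le_abs_self c
    linarith

namespace IsSolution

variable {a b x m y n : ℕ}

theorem add_mul_log_left_le (h : IsSolution a b x m y n) :
    (x + m) * Real.log a ≤ Real.log (a ^ (x + m) + a ^ x : ℕ) := by
  have ha := h.one_lt_left
  rw [← Nat.cast_add, ← Real.log_pow, ← Nat.cast_pow]
  exact Real.log_le_log (by positivity) (Nat.cast_le.2 (Nat.le_add_right _ _))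

theorem le_add_mul_log_left (h : IsSolution a b x m y n) :
    Real.log (a ^ (x + m) + a ^ x : ℕ) ≤ (x + m) * Real.log a + Real.log 2 := by
  have ha := h.one_lt_left
  rw [← Nat.cast_add, ← Real.log_pow, ← Nat.cast_pow, ← Real.log_mul (by positivity) (by norm_num)]
  refine Real.log_le_log (by positivity) ?_
  have : a ^ x ≤ a ^ (x + m) := Nat.pow_le_pow_right (by omega) (Nat.le_add_right _ _)
  exact_mod_cast (by omega : a ^ (x + m) + a ^ x ≤ a ^ (x + m) * 2)

theorem add_mul_log_right_le (h : IsSolution a b x m y n) :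
    (y + n) * Real.log b ≤ Real.log (a ^ (x + m) + a ^ x : ℕ) := by
  rw [h.eq]
  exact h.symm.add_mul_log_left_le

theorem le_add_mul_log_right (h : IsSolution a b x m y n) :
    Real.log (a ^ (x + m) + a ^ x : ℕ) ≤ (y + n) * Real.log b + Real.log 2 := by
  rw [h.eq]
  exact h.symm.le_add_mul_log_left

theorem log_two_le_log_left (h : IsSolution a b x m y n) : Real.log 2 ≤ Real.log a :=
  Real.log_le_log (by norm_num) (by exact_mod_cast h.one_lt_left)

end IsSolution

theorem le_of_mul_log_eq {x y : ℕ} {T s l A B u v : ℝ} (hne : x ≠ y) (hs : 0 ≤ s)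
    (hT : 0 ≤ T) (hl : 0 ≤ l) (hu₀ : 0 ≤ u) (hv₀ : 0 ≤ v)
    (hu : u ≤ 3 * s) (hv : v ≤ 3 * s) (heq : x * A - y * B = x * u - y * v)
    (hA₁ : (x + 1) * A ≤ T) (hA₂ : T ≤ (x + 1) * A + l) (hB₁ : (y + 1) * B ≤ T)
    (hB₂ : T ≤ (y + 1) * B + l) :
    T ≤ (x + 1) * (y + 1) * (x + 1 + (y + 1)) * (l + 3 * s) := by
  have key : ∀ {x y : ℕ} {A B u v : ℝ}, y < x → 0 ≤ v → u ≤ 3 * s →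
      x * A - y * B = x * u - y * v → T ≤ (x + 1) * A + l → (y + 1) * B ≤ T →
      T ≤ (x + 1) * (y + 1) * (x + 1 + (y + 1)) * (l + 3 * s) := by
    intro x y A B u v hyx hv hu heq hA hB
    have hyx' : (y : ℝ) + 1 ≤ x := by exact_mod_cast hyx
    have hy : (0 : ℝ) ≤ y := y.cast_nonneg
    have h1 : (x * (y + 1)) * T ≤ (x * (y + 1)) * ((x + 1) * A + l) :=
      mul_le_mul_of_nonneg_left hA (by positivity)
    have h2 : (y * (x + 1)) * ((y + 1) * B) ≤ (y * (x + 1)) * T :=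
      mul_le_mul_of_nonneg_left hB (by positivity)
    have h3 : (x + 1) * (y + 1) * (x * A - y * B) ≤ (x + 1) * (y + 1) * (x * (3 * s)) := by
      rw [heq]
      gcongr
      have h4 : (0 : ℝ) ≤ y * v := by positivity
      have h5 : x * u ≤ x * (3 * s) := mul_le_mul_of_nonneg_left hu (by positivity)
      linarith
    have h6 : 1 * T ≤ (x - y) * T := mul_le_mul_of_nonneg_right (by linarith) hT
    have h7 : (0 : ℝ) ≤ (x + 1) * (y + 1) * (y + 2) * (3 * s) := by positivity
    have h8 : (0 : ℝ) ≤ (y + 1) * (x ^ 2 + x * (y + 2) + (y + 2)) * l := by positivity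
    linarith
  rcases lt_or_gt_of_ne hne with h | h
  · have := key h hu₀ hv (by linarith) hB₂ hA₁
    linarith
  · exact key h hv₀ hu heq hA₂ hB₁

theorem ABCConjecture.exists_log_le_of_exponents (habc : ABCConjecture) (x m y n : ℕ) :
    ∃ T : ℝ, ∀ {a b : ℕ}, IsSolution a b x m y n → Real.log (a ^ (x + m) + a ^ x : ℕ) ≤ T := by
  by_cases hxm : (0 < x ∧ 0 < m) ∧ (0 < y ∧ 0 < n) ∧ x * n ≠ y * m
  swap
  · exact ⟨0, fun H ↦ absurd ⟨⟨H.x_pos, H.m_pos⟩, ⟨H.y_pos, H.n_pos⟩, H.mul_ne⟩ hxm⟩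
  obtain ⟨⟨hx, hm⟩, ⟨hy, hn⟩, hne⟩ := hxm
  have hx1 : (1 : ℝ) ≤ x := by exact_mod_cast hx
  have hm1 : (1 : ℝ) ≤ m := by exact_mod_cast hm
  have hy1 : (1 : ℝ) ≤ y := by exact_mod_cast hy
  have hn1 : (1 : ℝ) ≤ n := by exact_mod_cast hn
  set K : ℝ := (x + m) * (y + n) * (x + m + (y + n)) with hK
  have hK0 : 0 < K := by positivity
  have hlog2 : 0 < Real.log 2 := Real.log_pos (by norm_num)
  obtain ⟨c, hc0, hc⟩ := habc.mul_log_add_mul_log_le hx hm hy hn hne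
    (δ := 1 / (100 * K)) (by positivity)
  refine ⟨2 * K * (Real.log 2 + 3 * (c + Real.log 2)), fun {a b} S ↦ ?_⟩
  obtain ⟨g, h, U, V, W, R, H⟩ := S.exists_isFactorization
  have key := hc H
  have hA₁ := S.add_mul_log_left_le
  have hA₂ := S.le_add_mul_log_left
  have hB₁ := S.add_mul_log_right_le
  have hB₂ := S.le_add_mul_log_right
  set T := Real.log (a ^ (x + m) + a ^ x : ℕ)
  set s := 1 / (100 * K) * T + c + Real.log 2 with hs
  have hT0 : 0 ≤ T := Real.log_natCast_nonneg _
  clear_value T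
  have hs0 : 0 ≤ s := by positivity
  clear_value s
  have hU : 0 ≤ Real.log U := Real.log_natCast_nonneg _
  have hV : 0 ≤ Real.log V := Real.log_natCast_nonneg _
  have hA : 0 ≤ Real.log a := Real.log_natCast_nonneg _
  have hB : 0 ≤ Real.log b := Real.log_natCast_nonneg _
  have ha := H.log_left
  have hb := H.symm.log_left
  have hr := H.log_radical_le
  have hr' := H.symm.log_radical_le
  have e₁ : y * Real.log V + (n - 1) * Real.log b ≤ Real.log U + s := by
    linarith [H.le_mul_log_left]
  have e₂ : x * Real.log U + (m - 1) * Real.log a ≤ Real.log V + s := by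
    linarith [H.symm.le_mul_log_left]
  suffices hT : T ≤ K * (Real.log 2 + 3 * s) by
    have : K * s = T / 100 + K * (c + Real.log 2) := by
      rw [hs]; field_simp; ring
    linarith
  have hyV : 0 ≤ (y - 1) * Real.log V := mul_nonneg (by linarith) hV
  have hxU : 0 ≤ (x - 1) * Real.log U := mul_nonneg (by linarith) hU
  have hmA : 0 ≤ (m - 1) * Real.log a := mul_nonneg (by linarith) hA
  have hnB : 0 ≤ (n - 1) * Real.log b := mul_nonneg (by linarith) hB
  have hK₁ : (x + m : ℝ) ≤ K := by
    rw [hK, mul_assoc]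
    exact le_mul_of_one_le_right (by positivity) (by nlinarith)
  have hK₂ : (y + n : ℝ) ≤ K := by
    rw [hK, mul_comm (x + m : ℝ), mul_assoc]
    exact le_mul_of_one_le_right (by positivity) (by nlinarith)
  have hKs : 0 ≤ K * s := mul_nonneg hK0.le hs0
  have hKl : 1 * Real.log 2 ≤ K * Real.log 2 := mul_le_mul_of_nonneg_right (by linarith) hlog2.le
  rcases Nat.lt_or_ge 1 n with hn2 | hn2
  · have hn2' : (2 : ℝ) ≤ n := by exact_mod_cast hn2
    have h1 : 1 * Real.log b ≤ (n - 1) * Real.log b :=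
      mul_le_mul_of_nonneg_right (by linarith) hB
    have h2 : (y + n) * Real.log b ≤ K * (2 * s) :=
      mul_le_mul hK₂ (by linarith) hB hK0.le
    linarith
  rcases Nat.lt_or_ge 1 m with hm2 | hm2
  · have hm2' : (2 : ℝ) ≤ m := by exact_mod_cast hm2
    have h1 : 1 * Real.log a ≤ (m - 1) * Real.log a :=
      mul_le_mul_of_nonneg_right (by linarith) hA
    have h2 : (x + m) * Real.log a ≤ K * (2 * s) :=
      mul_le_mul hK₁ (by linarith) hA hK0.le
    linarith
  obtain rfl : n = 1 := by omega
  obtain rfl : m = 1 := by omega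
  rw [mul_one, mul_one] at hne
  have hU' : x * Real.log U ≤ Real.log V + s := by linarith
  have hV' : y * Real.log V ≤ Real.log U + s := by linarith
  have huv : Real.log U ≤ 3 * s ∧ Real.log V ≤ 3 * s := by
    have hU₁ : Real.log U ≤ x * Real.log U := le_mul_of_one_le_left hU hx1
    have hV₁ : Real.log V ≤ y * Real.log V := le_mul_of_one_le_left hV hy1
    rcases Nat.lt_or_ge 1 x with hx2 | hx2
    · have hU₂ : 2 * Real.log U ≤ x * Real.log U :=
        mul_le_mul_of_nonneg_right (by exact_mod_cast hx2) hU
      constructor <;> linarith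
    · have hV₂ : 2 * Real.log V ≤ y * Real.log V :=
        mul_le_mul_of_nonneg_right (by exact_mod_cast (by omega : 2 ≤ y)) hV
      constructor <;> linarith
  have heq : x * Real.log a - y * Real.log b = x * Real.log U - y * Real.log V := by
    rw [ha, hb]
    linear_combination H.mul_log_eq
  rw [Nat.cast_one] at hA₁ hA₂ hB₁ hB₂ hK
  rw [hK]
  exact le_of_mul_log_eq hne hs0 hT0 hlog2.le hU hV huv.1 huv.2 heq hA₁ hA₂ hB₁ hB₂

theorem log_natCast_add_le {p q : ℕ} {t : ℝ} (hp : 0 < p) (hq : 0 < q) (hpt : Real.log p ≤ t)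
    (hqt : Real.log q ≤ t) : Real.log (p + q : ℕ) ≤ Real.log 2 + t := by
  rw [Real.log_le_iff_le_exp (by positivity)] at hpt hqt ⊢
  rw [Real.exp_add, Real.exp_log (by norm_num)]
  push_cast
  have := Real.exp_pos t
  linarith

namespace IsFactorization

variable {a b x m y n g h U V W R : ℕ}

theorem lcm_div_left_mul_log_radical_le (H : IsFactorization a b x m y n g h U V W R) :
    ((Nat.lcm x y / x : ℕ) : ℝ) * Real.log R ≤ Real.log a := by
  have hx : (0 : ℝ) < x := by exact_mod_cast H.isSolution.x_pos
  have h1 := H.lcm_mul_log_radical_le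
  rw [← Nat.mul_div_cancel' (Nat.dvd_lcm_left x y), Nat.cast_mul, mul_assoc] at h1
  have h2 := le_of_mul_le_mul_left h1 hx
  have h3 : 0 ≤ Real.log U := Real.log_natCast_nonneg _
  linarith [H.log_left]

theorem exponents_of_log_le (H : IsFactorization a b x m y n g h U V W R)
    (hr : 0 < Real.log R) (hM : y * Real.log V ≤ 1.01 * Real.log R)
    (hP : x * Real.log U + Real.log W ≤ 1.01 * Real.log R) :
    n = 1 ∧ ∃ k, m * k = 2 ∧ y = x * k := by
  have hx := H.isSolution.x_pos
  have hy := H.isSolution.y_pos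
  have hm := H.isSolution.m_pos
  have hn := H.isSolution.n_pos
  have hk := Nat.mul_div_cancel' (Nat.dvd_lcm_left x y)
  have hl := Nat.mul_div_cancel' (Nat.dvd_lcm_right x y)
  have hA := H.lcm_div_left_mul_log_radical_le
  have hB := H.symm.lcm_div_left_mul_log_radical_le
  rw [Nat.lcm_comm] at hB
  have hL : 0 < Nat.lcm x y := Nat.lcm_pos hx hy
  set k := Nat.lcm x y / x
  set l := Nat.lcm x y / y
  have hxU : 0 ≤ x * Real.log U := mul_nonneg (by positivity) (Real.log_natCast_nonneg _)
  have hnl : n * l < 2 := by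
    have h1 : (n : ℝ) * (l * Real.log R) ≤ n * Real.log b :=
      mul_le_mul_of_nonneg_left hB (by positivity)
    have h2 : ((n * l : ℕ) : ℝ) * Real.log R < (2 : ℕ) * Real.log R := by
      push_cast
      linarith [H.symm.mul_log_left_le]
    exact_mod_cast lt_of_mul_lt_mul_right h2 hr.le
  have hmk : m * k < 3 := by
    have h1 : (m : ℝ) * (k * Real.log R) ≤ m * Real.log a :=
      mul_le_mul_of_nonneg_left hA (by positivity)
    have h2 : ((m * k : ℕ) : ℝ) * Real.log R < (3 : ℕ) * Real.log R := by
      push_cast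
      linarith [H.mul_log_left_le]
    exact_mod_cast lt_of_mul_lt_mul_right h2 hr.le
  have hl0 : 0 < l := Nat.pos_of_ne_zero fun h0 ↦ by rw [h0, mul_zero] at hl; omega
  have hk0 : 0 < k := Nat.pos_of_ne_zero fun h0 ↦ by rw [h0, mul_zero] at hk; omega
  obtain ⟨hn1, hl1⟩ : n = 1 ∧ l = 1 := by
    have := Nat.mul_pos hn hl0
    exact mul_eq_one.1 (by omega)
  rw [hl1, mul_one] at hl
  refine ⟨hn1, k, ?_, by omega⟩
  have hmk0 := Nat.mul_pos hm hk0
  by_contra hne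
  obtain ⟨hm1, hk1⟩ : m = 1 ∧ k = 1 := mul_eq_one.1 (by omega)
  refine H.isSolution.mul_ne ?_
  rw [hn1, hm1, hl, ← hk, hk1, mul_one, mul_one]

theorem log_radical_lt_one (H : IsFactorization a b x m y n g h U V W R) (hlt : U ^ x < V ^ y)
    (hM : y * Real.log V ≤ 1.01 * Real.log R)
    (hP : x * Real.log U + Real.log W ≤ 1.01 * Real.log R)
    (hv : Real.log V ≤ 0.01 * Real.log R) : Real.log R < 1 := by
  by_contra! hr
  obtain ⟨hn, k, hmk, hy⟩ := H.exponents_of_log_le (by linarith) hM hP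
  have hU := H.U_pos
  have hV := H.V_pos
  have hh := H.h_pos
  have hgk : g = h ^ k := by
    refine Nat.pow_left_injective H.isSolution.x_pos.ne' ?_
    simp only
    rw [H.pow_eq, hy, ← pow_mul, mul_comm]
  have ham : a ^ m = h ^ 2 * U ^ m := by
    rw [H.left_eq, hgk, mul_pow, ← pow_mul, mul_comm k, hmk]
  have heq := H.pow_mul_eq
  rw [ham, hn, pow_one, H.right_eq] at heq
  obtain ⟨κ, hκ⟩ : ∃ κ, h * U ^ (x + m) = V ^ (y + 1) + κ := by
    refine Nat.exists_eq_add_of_le (Nat.le_of_mul_le_mul_left (c := h) ?_ hh)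
    have e1 : h * (h * U ^ (x + m)) = U ^ x * (h ^ 2 * U ^ m) := by ring
    have e2 : h * V ^ (y + 1) = V ^ y * (h * V) := by ring
    omega
  have hVy : V ^ y = U ^ x + h * κ := by
    have e1 : U ^ x * (h ^ 2 * U ^ m) = h * (V ^ (y + 1) + κ) := by rw [← hκ]; ring
    rw [e1] at heq
    have e2 : h * (V ^ (y + 1) + κ) = V ^ y * (h * V) + h * κ := by ring
    omega
  have hκ0 : 0 < κ := Nat.pos_of_ne_zero fun h0 ↦ by rw [h0, mul_zero] at hVy; omega
  have hdvd : h ∣ V * U ^ x + κ := by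
    refine (Nat.dvd_add_right (Dvd.intro (V * κ) rfl)).1 (Dvd.intro (U ^ (x + m)) ?_ :
      h ∣ h * (V * κ) + (V * U ^ x + κ))
    rw [hκ, pow_succ, hVy]
    ring
  have hle : h ≤ V * U ^ x + κ := Nat.le_of_dvd (by positivity) hdvd
  have hlog : Real.log h ≤ Real.log (V * U ^ x + κ : ℕ) :=
    Real.log_le_log (by positivity) (by exact_mod_cast hle)
  have hrh := H.symm.log_radical_le
  have hA : 2 * Real.log R ≤ m * Real.log a := by
    have hg : Real.log g = k * Real.log h := by rw [hgk, Nat.cast_pow, Real.log_pow]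
    have h1 : (m : ℝ) * (k * Real.log R) ≤ m * Real.log a := by
      refine mul_le_mul_of_nonneg_left ?_ (by positivity)
      have h2 : k * Real.log R ≤ k * Real.log h := mul_le_mul_of_nonneg_left hrh (by positivity)
      have h3 : 0 ≤ Real.log U := Real.log_natCast_nonneg _
      linarith [H.log_left]
    rw [← mul_assoc] at h1
    have h4 : (m * k : ℝ) = 2 := by exact_mod_cast hmk
    rwa [h4] at h1
  have hw := H.mul_log_left_le
  have hlogκ : Real.log κ ≤ 0.03 * Real.log R + 0.01 * Real.log R := by
    have h1 : Real.log (h * κ : ℕ) ≤ Real.log (V ^ y : ℕ) :=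
      Real.log_le_log (by positivity) (Nat.cast_le.2 (by omega))
    rw [Nat.cast_mul, Real.log_mul (by positivity) (by positivity), Nat.cast_pow, Real.log_pow]
      at h1
    linarith
  have hlogVU : Real.log (V * U ^ x : ℕ) ≤ 0.03 * Real.log R + 0.01 * Real.log R := by
    rw [Nat.cast_mul, Real.log_mul (by positivity) (by positivity), Nat.cast_pow, Real.log_pow]
    linarith
  have hfin := log_natCast_add_le (by positivity) hκ0 hlogVU hlogκ
  have hlog2 := Real.log_two_lt_d9
  linarith

end IsFactorization

theorem half_le_of_add_mul_le {C x m A T l : ℝ} (hA : 0 < A) (hC : C ≤ x + m) (h₁ : (x + m) * A ≤ T)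
    (h₂ : T ≤ (x + m) * A + l) (h₃ : m * A + l ≤ T / 2) : C / 2 ≤ x := by
  have h4 : C * A ≤ (x + m) * A := mul_le_mul_of_nonneg_right hC hA.le
  refine le_of_mul_le_mul_right (a := A) ?_ hA
  linarith

theorem ABCConjecture.exists_log_le_of_pow_lt (habc : ABCConjecture) :
    ∃ C : ℕ, ∃ T : ℝ, ∀ {a b x m y n g h U V W R : ℕ}, IsFactorization a b x m y n g h U V W R →
      U ^ x < V ^ y → C ≤ x + m → C ≤ y + n → Real.log (a ^ (x + m) + a ^ x : ℕ) ≤ T := by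
  obtain ⟨c₁, hc₁0, hc₁⟩ := habc.left_add_one_le (ε := 0.001) (by norm_num)
  obtain ⟨c₃, hc₃0, hc₃⟩ := habc.sub_le (ε := 0.001) (by norm_num)
  have hlog2 : 0.69 < Real.log 2 := by linarith [Real.log_two_gt_d9]
  have hlog2' : Real.log 2 < 0.7 := by linarith [Real.log_two_lt_d9]
  obtain ⟨C, hC⟩ := exists_nat_ge (100000 + 4000 * (c₁ + c₃))
  refine ⟨C, 100000 * (c₁ + c₃ + 1), fun {a b x m y n g h U V W R} H hlt hx hy ↦ ?_⟩
  by_contra! hT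
  have hx' : (C : ℝ) ≤ x + m := by exact_mod_cast hx
  have hy' : (C : ℝ) ≤ y + n := by exact_mod_cast hy
  have hA₁ := H.isSolution.add_mul_log_left_le
  have hA₂ := H.isSolution.le_add_mul_log_left
  have hB₁ := H.isSolution.add_mul_log_right_le
  have hB₂ := H.isSolution.le_add_mul_log_right
  have hsum := H.log_sum
  have hmA := H.mul_log_left_le
  have hnB := H.symm.mul_log_left_le
  have hA := H.isSolution.log_two_le_log_left
  have hB := H.isSolution.symm.log_two_le_log_left
  have ha := H.log_left
  have hb := H.symm.log_left
  have hrg := H.log_radical_le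
  have abc₁ := hc₁ H
  have abc₃ := hc₃ H hlt
  have hcontra := H.log_radical_lt_one hlt
  have hg : 0 ≤ Real.log g := Real.log_natCast_nonneg _
  have hh : 0 ≤ Real.log h := Real.log_natCast_nonneg _
  have hu : 0 ≤ Real.log U := Real.log_natCast_nonneg _
  have hw : 0 ≤ Real.log W := Real.log_natCast_nonneg _
  have hr : 0 ≤ Real.log R := Real.log_natCast_nonneg _
  have hv : Real.log 2 ≤ Real.log V := by
    refine Real.log_le_log (by norm_num) ?_
    have hU := Nat.pow_pos (n := x) H.U_pos
    have hV1 : V ≠ 1 := fun h1 ↦ by rw [h1, one_pow] at hlt; omega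
    have hV := H.V_pos
    exact_mod_cast (by omega : 2 ≤ V)
  generalize Real.log (a ^ (x + m) + a ^ x : ℕ) = T at *
  generalize Real.log a = A at *
  generalize Real.log b = B at *
  generalize Real.log U = u at *
  generalize Real.log V = v at *
  generalize Real.log W = w at *
  generalize Real.log R = r at *
  have hxg : 0 ≤ x * Real.log g := by positivity
  have hxu : 0 ≤ x * u := by positivity
  have hAT : 100000 * A ≤ (x + m) * A := mul_le_mul_of_nonneg_right (by linarith) (by linarith)
  have hBT : 100000 * B ≤ (y + n) * B := mul_le_mul_of_nonneg_right (by linarith) (by linarith)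
  have hx2 : (C : ℝ) / 2 ≤ x :=
    half_le_of_add_mul_le (by linarith) hx' hA₁ hA₂ (by linarith)
  have hy2 : (C : ℝ) / 2 ≤ y :=
    half_le_of_add_mul_le (by linarith) hy' hB₁ hB₂ (by linarith)
  have hM : (C / 2) * 0.69 ≤ y * v := mul_le_mul hy2 (by linarith) (by norm_num) (by positivity)
  have hyv : 10000 * v ≤ y * v := mul_le_mul_of_nonneg_right (by linarith) (by linarith)
  have hxu' : 10000 * u ≤ x * u := mul_le_mul_of_nonneg_right (by linarith) (by linarith)
  have h1 : y * v ≤ 1.01 * r := by linarith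
  have h2 : x * u + w ≤ 1.01 * r := by linarith
  have h3 := hcontra h1 h2 (by linarith)
  linarith

theorem ABCConjecture.exists_log_le_of_le (habc : ABCConjecture) :
    ∃ C : ℕ, ∃ T : ℝ, ∀ {a b x m y n : ℕ}, IsSolution a b x m y n → C ≤ x + m → C ≤ y + n →
      Real.log (a ^ (x + m) + a ^ x : ℕ) ≤ T := by
  obtain ⟨C, T, hT⟩ := habc.exists_log_le_of_pow_lt
  refine ⟨C, T, fun {a b x m y n} S hx hy ↦ ?_⟩
  obtain ⟨g, h, U, V, W, R, H⟩ := S.exists_isFactorization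
  rcases lt_or_gt_of_ne H.pow_ne with hlt | hlt
  · exact hT H hlt hx hy
  · rw [S.eq]
    exact hT H.symm hlt hy hx

theorem IsFactorization.pow_min_dvd {a b x m g h U V W R : ℕ}
    (H : IsFactorization a b x m 1 1 g h U V W R) : U ^ min m x ∣ h + W := by
  have h1 : h * a ^ m + (h + W) = U ^ x * (W * W) := by
    have e1 := H.left_add_one
    have e2 := H.right_add_one
    rw [pow_one] at e1 e2
    rw [H.right_eq] at e2
    calc h * a ^ m + (h + W) = h * (a ^ m + 1) + W := by ring
      _ = (h * V + 1) * W := by rw [e1]; ring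
      _ = _ := by rw [e2]; ring
  refine (Nat.dvd_add_right (Dvd.dvd.mul_left ?_ h)).1
    (h1 ▸ Dvd.dvd.mul_right (pow_dvd_pow U (min_le_right m x)) _)
  exact (pow_dvd_pow U (min_le_left m x)).trans
    (pow_dvd_pow_of_dvd (H.left_eq ▸ Dvd.intro_left g rfl) m)

theorem IsFactorization.min_mul_log_le {a b x m g h U V W R : ℕ}
    (H : IsFactorization a b x m 1 1 g h U V W R) {t : ℝ} (hh : Real.log h ≤ t)
    (hW : Real.log W ≤ t) : ((min m x : ℕ) : ℝ) * Real.log U ≤ Real.log 2 + t := by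
  have hU := H.U_pos
  have hh0 := H.h_pos
  refine le_trans ?_ (log_natCast_add_le H.h_pos H.W_pos hh hW)
  rw [← Real.log_pow]
  exact Real.log_le_log (by positivity)
    (by exact_mod_cast Nat.le_of_dvd (by positivity) H.pow_min_dvd)

theorem ABCConjecture.log_right_le (habc : ABCConjecture) {ε : ℝ} (hε : 0 < ε) :
    ∃ c : ℝ, 0 ≤ c ∧ ∀ {a b x m : ℕ}, IsSolution a b x m 1 1 →
      Real.log b ≤ (1 + ε) * (Real.log a + x * Real.log a) + ε * Real.log b + c := by
  obtain ⟨c, hc0, hc⟩ := habc.sq_le hε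
  have hlog2 : 0 < Real.log 2 := Real.log_pos (by norm_num)
  refine ⟨c + (1 + ε) * (6 * Real.log 2), by positivity, fun {a b x m} S ↦ ?_⟩
  have ha := S.one_lt_left
  have hb := S.one_lt_right
  have hlog4 : Real.log (4 : ℝ) = 2 * Real.log 2 := by
    rw [show (4 : ℝ) = 2 ^ 2 by norm_num, Real.log_pow]; norm_num
  have hlog8 : Real.log (8 : ℝ) = 3 * Real.log 2 := by
    rw [show (8 : ℝ) = 2 ^ 3 by norm_num, Real.log_pow]; norm_num
  have h1 : Real.log b ≤ Real.log (2 * b + 1 : ℕ) :=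
    Real.log_le_log (by positivity) (Nat.cast_le.2 (by omega))
  have h2 : Real.log (2 * b + 1 : ℕ) ≤ 2 * Real.log 2 + Real.log b := by
    rw [← hlog4, ← Real.log_mul (by norm_num) (by positivity)]
    exact Real.log_le_log (by positivity) (by exact_mod_cast (by omega : 2 * b + 1 ≤ 4 * b))
  have h3 : Real.log (2 * a : ℕ) = Real.log 2 + Real.log a := by
    rw [Nat.cast_mul, Real.log_mul (by norm_num) (by positivity), Nat.cast_ofNat]
  have h4 : Real.log (4 * a ^ x + 1 : ℕ) ≤ 3 * Real.log 2 + x * Real.log a := by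
    rw [← hlog8, ← Real.log_pow, ← Real.log_mul (by norm_num) (by positivity)]
    have : 0 < a ^ x := by positivity
    exact Real.log_le_log (by positivity)
      (by exact_mod_cast (by omega : 4 * a ^ x + 1 ≤ 8 * a ^ x))
  have h5 := hc S
  have h6 : (1 + ε) * (Real.log (2 * a : ℕ) + Real.log (2 * b + 1 : ℕ) +
      Real.log (4 * a ^ x + 1 : ℕ)) ≤ (1 + ε) * (6 * Real.log 2 + Real.log a + Real.log b +
        x * Real.log a) := by
    refine mul_le_mul_of_nonneg_left ?_ (by positivity)
    linarith
  linarith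

theorem ABCConjecture.exists_log_le_of_le_of_le (habc : ABCConjecture) (C : ℕ) :
    ∃ C' : ℕ, ∃ T : ℝ, ∀ {a b x m y n : ℕ}, IsSolution a b x m y n → C' ≤ x + m → y + n ≤ C →
      Real.log (a ^ (x + m) + a ^ x : ℕ) ≤ T := by
  set ε : ℝ := 1 / (1000 * (C + 1)) with hε
  have hε0 : 0 < ε := by positivity
  have hCε : C * ε ≤ 1 / 1000 := by
    rw [hε]; field_simp; linarith
  have hε1 : ε ≤ 1 / 1000 := by
    rw [hε]
    exact one_div_le_one_div_of_le (by norm_num) (by linarith [C.cast_nonneg (α := ℝ)])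
  obtain ⟨c₁, hc₁0, hc₁⟩ := habc.left_add_one_le hε0
  obtain ⟨c₃, hc₃0, hc₃⟩ := habc.sub_le hε0
  obtain ⟨c₄, hc₄0, hc₄⟩ := habc.log_right_le hε0
  have hlog2 : 0 < Real.log 2 := Real.log_pos (by norm_num)
  obtain ⟨C', hC'⟩ := exists_nat_ge (1 / ε)
  refine ⟨C', (c₁ + c₃ + c₄ + Real.log 2) / ε, fun {a b x m y n} S hx hy ↦ ?_⟩
  obtain ⟨g, h, U, V, W, R, H⟩ := S.exists_isFactorization
  by_contra! hT
  rw [div_lt_iff₀ hε0] at hT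
  have hA₁ := S.add_mul_log_left_le
  have hA₂ := S.le_add_mul_log_left
  have hB₁ := S.add_mul_log_right_le
  have hB₂ := S.le_add_mul_log_right
  have hsum := H.log_sum
  have hmA := H.mul_log_left_le
  have hnB := H.symm.mul_log_left_le
  have hA := S.log_two_le_log_left
  have hB := S.symm.log_two_le_log_left
  have ha := H.log_left
  have hb := H.symm.log_left
  have hrg := H.log_radical_le
  have hrh := H.symm.log_radical_le
  have abc₁ := hc₁ H
  have abc₂ := hc₁ H.symm
  have hg : 0 ≤ Real.log g := Real.log_natCast_nonneg _
  have hh : 0 ≤ Real.log h := Real.log_natCast_nonneg _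
  have hu : 0 ≤ Real.log U := Real.log_natCast_nonneg _
  have hv : 0 ≤ Real.log V := Real.log_natCast_nonneg _
  have hw : 0 ≤ Real.log W := Real.log_natCast_nonneg _
  have hr : 0 ≤ Real.log R := Real.log_natCast_nonneg _
  have hgh := H.mul_log_eq
  set T := Real.log (a ^ (x + m) + a ^ x : ℕ)
  have hy1 : (1 : ℝ) ≤ y := by exact_mod_cast S.y_pos
  have hn1 : (1 : ℝ) ≤ n := by exact_mod_cast S.n_pos
  have hT0 : 0 ≤ T := Real.log_natCast_nonneg _
  clear_value T
  have hAT : Real.log a ≤ T * ε := by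
    have h1 : 1 / ε * Real.log a ≤ (x + m) * Real.log a :=
      mul_le_mul_of_nonneg_right (hC'.trans (by exact_mod_cast hx)) (by linarith)
    rw [one_div, inv_mul_eq_div] at h1
    rw [← div_le_iff₀ hε0]
    linarith
  have hxg : 0 ≤ x * Real.log g := by positivity
  have hxu : 0 ≤ x * Real.log U := by positivity
  have hyv : Real.log V ≤ y * Real.log V := le_mul_of_one_le_left hv hy1
  have hBn : 0 ≤ (n - 1) * Real.log b := mul_nonneg (by linarith) (by linarith)
  have hεT : ∀ {z : ℝ}, z ≤ 3 * T → ε * z ≤ 3 * (T * ε) := fun hz ↦ by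
    linarith [mul_le_mul_of_nonneg_left hz hε0.le]
  have hεT1 : T * ε ≤ T * (1 / 1000) := mul_le_mul_of_nonneg_left hε1 hT0
  have hB0 : Real.log b ≤ T :=
    (le_mul_of_one_le_left (by linarith) (by linarith)).trans hB₁
  have hyv' : (y - 1) * Real.log V ≤ 6 * (T * ε) := by
    linarith [hεT (z := Real.log R + Real.log U + Real.log V + Real.log W) (by linarith)]
  have hxu' : x * Real.log U ≤ Real.log V + 6 * (T * ε) := by
    linarith [hεT (z := Real.log R + Real.log V + Real.log U + Real.log W) (by linarith)]
  have hxuw : x * Real.log U + Real.log W ≤ Real.log V + 12 * (T * ε) := by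
    rcases lt_or_gt_of_ne H.pow_ne with hlt | hlt
    · linarith [hc₃ H hlt,
        hεT (z := Real.log R + Real.log U + Real.log V + y * Real.log V) (by linarith)]
    · linarith [hc₃ H.symm hlt,
        hεT (z := Real.log R + Real.log V + Real.log U + x * Real.log U) (by linarith)]
  have hBT : 20 * (T * ε) < Real.log b := by
    by_contra! hle
    have h1 : (y + n) * Real.log b ≤ C * Real.log b :=
      mul_le_mul_of_nonneg_right (by exact_mod_cast hy) (by linarith)
    have h2 : C * Real.log b ≤ C * (20 * (T * ε)) :=
      mul_le_mul_of_nonneg_left hle C.cast_nonneg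
    have h3 : T * (C * ε) ≤ T * (1 / 1000) := mul_le_mul_of_nonneg_left hCε hT0
    linarith
  have hn2 : n < 2 := by
    by_contra! hn2
    have h1 : 1 * Real.log b ≤ (n - 1) * Real.log b :=
      mul_le_mul_of_nonneg_right (by have : (2 : ℝ) ≤ n := (by exact_mod_cast hn2); linarith)
        (by linarith)
    linarith
  have hy2 : y < 2 := by
    by_contra! hy2
    have h1 : 1 * Real.log V ≤ (y - 1) * Real.log V :=
      mul_le_mul_of_nonneg_right (by have : (2 : ℝ) ≤ y := (by exact_mod_cast hy2); linarith) hv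
    linarith
  obtain rfl : n = 1 := by have := S.n_pos; omega
  obtain rfl : y = 1 := by have := S.y_pos; omega
  have hb₄ := hc₄ S
  rw [Nat.cast_one] at *
  have hxA : Real.log b ≤ x * Real.log a + 10 * (T * ε) := by
    have hmA0 : 0 ≤ m * Real.log a := mul_nonneg m.cast_nonneg (by linarith)
    linarith [hεT (z := Real.log a + x * Real.log a + Real.log b) (by linarith)]
  have hxa : x * Real.log a = x * Real.log g + x * Real.log U := by rw [ha]; ring
  have h2m : (x : ℝ) ≤ 2 * m := by
    refine le_of_mul_le_mul_right (a := Real.log a) ?_ (by linarith)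
    linarith
  have hmin : x * Real.log U ≤ 2 * (((min m x : ℕ) : ℝ) * Real.log U) := by
    rw [← mul_assoc]
    refine mul_le_mul_of_nonneg_right ?_ hu
    rcases min_choice m x with hmx | hmx <;> rw [hmx]
    · exact h2m
    · linarith [x.cast_nonneg (α := ℝ)]
  have hfin := H.min_mul_log_le (t := 40 * (T * ε)) (by linarith) (by linarith)
  linarith

theorem ABCConjecture.exists_log_le (habc : ABCConjecture) :
    ∃ T : ℝ, ∀ {a b x m y n : ℕ}, IsSolution a b x m y n →
      Real.log (a ^ (x + m) + a ^ x : ℕ) ≤ T := by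
  obtain ⟨C, T₁, h₁⟩ := habc.exists_log_le_of_le
  obtain ⟨C', T₂, h₂⟩ := habc.exists_log_le_of_le_of_le C
  choose f hf using habc.exists_log_le_of_exponents
  set K := C + C' + 1
  obtain ⟨T₃, h₃⟩ := (Set.finite_range fun p : Fin K × Fin K × Fin K × Fin K ↦
    f p.1 p.2.1 p.2.2.1 p.2.2.2).bddAbove
  refine ⟨max T₁ (max T₂ T₃), fun {a b x m y n} S ↦ ?_⟩
  by_cases hC : C ≤ x + m ∧ C ≤ y + n
  · exact (h₁ S hC.1 hC.2).trans (le_max_left _ _)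
  refine le_trans ?_ (le_max_right _ _)
  by_cases hx : C' ≤ x + m ∧ y + n ≤ C
  · exact (h₂ S hx.1 hx.2).trans (le_max_left _ _)
  by_cases hy : C' ≤ y + n ∧ x + m ≤ C
  · rw [S.eq]
    exact (h₂ S.symm hy.1 hy.2).trans (le_max_left _ _)
  refine ((hf x m y n S).trans ?_).trans (le_max_right _ _)
  exact h₃ ⟨(⟨x, by omega⟩, ⟨m, by omega⟩, ⟨y, by omega⟩, ⟨n, by omega⟩), rfl⟩

theorem IsSolution.le_sum {a b x m y n : ℕ} (S : IsSolution a b x m y n) :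
    a ≤ a ^ (x + m) + a ^ x ∧ x + m ≤ a ^ (x + m) + a ^ x :=
  ⟨(Nat.le_self_pow (by have := S.x_pos; omega) a).trans (Nat.le_add_right _ _),
    (Nat.lt_pow_self S.one_lt_left).le.trans (Nat.le_add_right _ _)⟩

theorem stmt15 (habc : ABCConjecture) :
    {T : ℕ × ℕ × ℕ × ℕ × ℕ × ℕ |
      1 < T.1 ∧ 1 < T.2.1 ∧
      0 < T.2.2.2.1 ∧ T.2.2.2.1 < T.2.2.1 ∧
      0 < T.2.2.2.2.2 ∧ T.2.2.2.2.2 < T.2.2.2.2.1 ∧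
      T.1 ^ T.2.2.1 ≠ T.2.1 ^ T.2.2.2.2.1 ∧
      T.1 ^ T.2.2.1 + T.1 ^ T.2.2.2.1 =
        T.2.1 ^ T.2.2.2.2.1 + T.2.1 ^ T.2.2.2.2.2}.Finite := by
  obtain ⟨T, hT⟩ := habc.exists_log_le
  obtain ⟨M, hM⟩ := exists_nat_ge (Real.exp T)
  refine (Set.finite_Iic (M, M, M, M, M, M)).subset ?_
  rintro ⟨a, b, x₁, x, y₁, y⟩ ⟨ha, hb, hx, hxx, hy, hyy, hne, heq⟩
  simp only at ha hb hx hxx hy hyy hne heq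
  obtain ⟨m, rfl⟩ := Nat.exists_eq_add_of_lt hxx
  obtain ⟨n, rfl⟩ := Nat.exists_eq_add_of_lt hyy
  have S : IsSolution a b x (m + 1) y (n + 1) :=
    ⟨ha, hb, hx, m.succ_pos, hy, n.succ_pos, hne, heq⟩
  have hN : a ^ (x + (m + 1)) + a ^ x ≤ M := by
    have h1 := hT S
    rw [Real.log_le_iff_le_exp (by positivity)] at h1
    exact_mod_cast h1.trans hM
  have h1 := S.le_sum
  have h2 := S.symm.le_sum
  rw [← S.eq] at h2
  simp only [Set.mem_Iic, Prod.mk_le_mk]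
  omega
end
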